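/- arXiv:2202.04481 — 3 statements merged into one kernel-verified Lean document; each statement's English description precedes it below -/
import Mathlib

section
/- Fix d > 0 and a distortion measure ρ ∈ D. Then the minimax redundancy over deterministic prefix d-semifaithful codes satisfies inf_{(φ_n,f_n,g_n) prefix d-semifaithful} sup_{p ∈ P(A)} [ (ln 2 / n)·E_p[ l(f_n(φ_n(X^n))) ] − R(p,d,ρ) ] = O( (ln n)^{3/2} / √n ) as n → ∞. -/
open Filter MeasureTheory
open scoped BigOperators

noncomputable section

variable {A B : Type*}

/-- `p` is a probability distribution on the finite alphabet `A`. -/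
def IsProb [Fintype A] (p : A → ℝ) : Prop :=
  (∀ a, 0 ≤ p a) ∧ ∑ a, p a = 1

/-- `Q` is a conditional probability distribution from `A` to `B`. -/
def IsCondProb [Fintype A] [Fintype B] (Q : A → B → ℝ) : Prop :=
  ∀ j, IsProb (Q j)

/-- `ρ` is a distortion measure in the class `D`: bounded in `[0, ρmax]` and
with `max_j min_k ρ(j,k) = 0` (equivalently, every row contains a zero). -/
def IsDistMeasure [Fintype A] [Fintype B] (ρmax : ℝ) (ρ : A → B → ℝ) : Prop :=
  (∀ j k, 0 ≤ ρ j k ∧ ρ j k ≤ ρmax) ∧ ∀ j, ∃ k, ρ j k = 0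

/-- Mutual information `I(p, Q)` in nats. -/
def mutualInfo [Fintype A] [Fintype B] (p : A → ℝ) (Q : A → B → ℝ) : ℝ :=
  ∑ j, ∑ k, p j * Q j k * Real.log (Q j k / ∑ j', p j' * Q j' k)

/-- Average distortion `Σ_{j,k} p(j) Q(k|j) ρ(j,k)`. -/
def avgDist [Fintype A] [Fintype B] (p : A → ℝ) (Q : A → B → ℝ) (ρ : A → B → ℝ) : ℝ :=
  ∑ j, ∑ k, p j * Q j k * ρ j k

/-- The rate-distortion function `R(p,d,ρ)` in nats. -/
def RD [Fintype A] [Fintype B] (p : A → ℝ) (d : ℝ) (ρ : A → B → ℝ) : ℝ :=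
  sInf { r | ∃ Q, IsCondProb Q ∧ avgDist p Q ρ ≤ d ∧ r = mutualInfo p Q }

/-- The type (empirical distribution) of a sequence `x ∈ A^n`. -/
def typeOf [DecidableEq A] {n : ℕ} (x : Fin n → A) : A → ℝ :=
  fun a => ((Finset.univ.filter fun i => x i = a).card : ℝ) / n

/-- The i.i.d. product probability `p^n(x) = ∏ i p(x_i)`. -/
def prodProb {n : ℕ} (p : A → ℝ) (x : Fin n → A) : ℝ :=
  ∏ i, p (x i)

/-- The `n`-fold single-letter distortion `ρ_n(x,y) = (1/n) Σ_i ρ(x_i, y_i)`. -/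
def nDist {n : ℕ} (ρ : A → B → ℝ) (x : Fin n → A) (y : Fin n → B) : ℝ :=
  (∑ i, ρ (x i) (y i)) / n

/-- `E_p[R(T,d,ρ)]`, the expectation of the empirical rate-distortion function
over `X^n` i.i.d. `p` (written as a sum over sequences). -/
def expTypeRD [Fintype A] [DecidableEq A] [Fintype B] (n : ℕ) (p : A → ℝ)
    (d : ℝ) (ρ : A → B → ℝ) : ℝ :=
  ∑ x : Fin n → A, prodProb p x * RD (typeOf x) d ρ

theorem kl_ge (w q : ℝ) (hw : 0 ≤ w) (hq : 0 < q) : w - q ≤ w * Real.log (w / q) := by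
  rcases hw.eq_or_lt with h | h
  · subst h; simp; exact hq.le
  · have h1 := Real.log_le_sub_one_of_pos (div_pos hq h)
    have h2 : Real.log (w / q) = - Real.log (q / w) := by
      rw [← Real.log_inv, inv_div]
    rw [h2]
    have h3 : w * (q / w) = q := by field_simp
    nlinarith

theorem dv_bound {Y : Type*} [Fintype Y] [DecidableEq Y] (W M : Y → ℝ) (hW : ∀ y, 0 ≤ W y)
    (hW1 : ∑ y, W y = 1) (hM : ∀ y, 0 < M y) (hM1 : ∑ y, M y = 1) (S : Finset Y)
    (hS : 0 < ∑ y ∈ S, M y) :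
    (∑ y ∈ S, W y) * (- Real.log (∑ y ∈ S, M y)) ≤
      ∑ y, W y * Real.log (W y / M y) + Real.log 2 := by
  set m := ∑ y ∈ S, M y with hm
  have key : ∀ y, W y - M y * (if y ∈ S then 1 / m else 1) / 2 ≤
      W y * Real.log (W y / M y) + W y * Real.log 2 + (if y ∈ S then W y * Real.log m else 0) := by
    intro y
    have hq : 0 < M y * (if y ∈ S then 1 / m else 1) / 2 := by
      have := hM y
      split_ifs <;> positivity
    refine (kl_ge _ _ (hW y) hq).trans (le_of_eq ?_)
    rcases (hW y).eq_or_lt with h | h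
    · simp [← h]
    · have := hM y
      split_ifs with hy
      · rw [show W y / (M y * (1 / m) / 2) = (W y / M y) * 2 * m by field_simp,
          Real.log_mul (by positivity) (by positivity), Real.log_mul (by positivity) (by positivity)]
        ring
      · rw [show W y / (M y * 1 / 2) = (W y / M y) * 2 by field_simp,
          Real.log_mul (by positivity) (by positivity)]
        ring
  have hsum := Finset.sum_le_sum (fun y (_ : y ∈ Finset.univ) => key y)
  simp only [Finset.sum_sub_distrib, Finset.sum_add_distrib, ← Finset.sum_mul, hW1,
    Finset.sum_ite_mem, Finset.univ_inter, ← Finset.sum_div] at hsum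
  have h2 : ∑ y, M y * (if y ∈ S then 1 / m else 1) ≤ 2 := by
    calc ∑ y, M y * (if y ∈ S then 1 / m else 1)
        ≤ ∑ y, ((if y ∈ S then M y * (1 / m) else 0) + M y) := by
          apply Finset.sum_le_sum
          intro y _
          have := hM y
          split_ifs
          · linarith
          · linarith
      _ = 2 := by
          rw [Finset.sum_add_distrib, Finset.sum_ite_mem, Finset.univ_inter, ← Finset.sum_mul,
            hM1, ← hm]
          field_simp; norm_num
  linarith

theorem log_sum2 (a b c e : ℝ) (ha : 0 ≤ a) (hb : 0 ≤ b) (hc : 0 ≤ c) (he : 0 < e)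
    (hac : c = 0 → a = 0) :
    (a + b) * Real.log ((a + b) / (c + e)) ≤ a * Real.log (a / c) + b * Real.log (b / e) := by
  have key : ∀ a' c' : ℝ, 0 ≤ a' → 0 ≤ c' → (c' = 0 → a' = 0) → 0 < a + b → a' - c' * (a + b) / (c + e) ≤
      a' * Real.log (a' / c') - a' * Real.log ((a + b) / (c + e)) := by
    intro a' c' ha' hc' h hab
    rcases hc'.eq_or_lt with h0 | h0
    · rw [h h0.symm, ← h0]; simp
    · have h3 : 0 < c' * (a + b) / (c + e) := by positivity
      refine (kl_ge a' _ ha' h3).trans (le_of_eq ?_)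
      rcases ha'.eq_or_lt with h1 | h1
      · simp [← h1]
      · rw [show a' / (c' * (a + b) / (c + e)) = (a' / c') / ((a + b) / (c + e)) by field_simp,
          Real.log_div (by positivity) (by positivity)]
        ring
  rcases (add_nonneg ha hb).eq_or_lt with h | h
  · have h1 : a = 0 := by linarith
    have h2 : b = 0 := by linarith
    simp [h1, h2]
  · have k1 := key a c ha hc hac h
    have k2 := key b e hb he.le (fun h => absurd h he.ne') h
    have k3 : c * (a + b) / (c + e) + e * (a + b) / (c + e) = a + b := by
      field_simp
    nlinarith

theorem sum_prod_mul_sum {Z : Type*} [Fintype Z] [DecidableEq Z] (n : ℕ) (w g : Z → ℝ) (hw : ∑ z, w z = 1) :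
    ∑ z : Fin n → Z, (∏ i, w (z i)) * ∑ i, g (z i) = n * ∑ z, w z * g z := by
  simp_rw [Finset.mul_sum]
  rw [Finset.sum_comm]
  have : ∀ i : Fin n, ∑ z : Fin n → Z, (∏ i', w (z i')) * g (z i) = ∑ z, w z * g z := by
    intro i
    have h1 : ∀ z : Fin n → Z, (∏ i', w (z i')) * g (z i) =
        ∏ i', (w (z i') * if i' = i then g (z i') else 1) := by
      intro z
      rw [Finset.prod_mul_distrib, Finset.prod_ite_eq']
      simp
    simp_rw [h1]
    have h2 := Finset.prod_univ_sum (fun _ : Fin n => (Finset.univ : Finset Z))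
      (fun i' z => w z * if i' = i then g z else 1)
    rw [Fintype.piFinset_univ] at h2
    rw [← h2, Finset.prod_eq_single i]
    · simp
    · intro b _ hb
      simp [hb, hw]
    · simp
  simp_rw [this]
  simp [Finset.mul_sum]

theorem exists_seq {X Y : Type*} [Fintype X] [Fintype Y] [DecidableEq Y] (M : Y → ℝ)
    (hM0 : ∀ y, 0 ≤ M y) (hM1 : ∑ y, M y = 1) (S : X → Finset Y) (N : X → ℕ)
    (h : ∑ x, (1 - ∑ y ∈ S x, M y) ^ (N x) < 1) :
    ∃ u : ℕ → Y, ∀ x, ∃ i, i < N x ∧ u i ∈ S x := by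
  classical
  have hne : Nonempty Y := by
    by_contra hn
    rw [not_nonempty_iff] at hn
    simp at hM1
  set T := ∑ x, N x with hT
  have hNT : ∀ x, N x ≤ T := fun x => Finset.single_le_sum (fun _ _ => Nat.zero_le _) (Finset.mem_univ x)
  suffices hs : ∃ u : Fin T → Y, ∀ x, ∃ i : Fin T, i.1 < N x ∧ u i ∈ S x by
    obtain ⟨u, hu⟩ := hs
    refine ⟨fun i => if hi : i < T then u ⟨i, hi⟩ else Classical.arbitrary Y, fun x => ?_⟩
    obtain ⟨i, hi, hi2⟩ := hu x
    exact ⟨i.1, hi, by simpa [i.2] using hi2⟩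
  by_contra! hcon
  have e1 : ∀ x, ∑ u : Fin T → Y, ∏ i, (M (u i) * if i.1 < N x ∧ u i ∈ S x then 0 else 1) =
      (1 - ∑ y ∈ S x, M y) ^ (N x) := by
    intro x
    have h2 := Finset.prod_univ_sum (fun _ : Fin T => (Finset.univ : Finset Y))
      (fun i y => M y * if i.1 < N x ∧ y ∈ S x then 0 else 1)
    rw [Fintype.piFinset_univ] at h2
    rw [← h2]
    have h3 : ∀ i : Fin T, ∑ y, (M y * if i.1 < N x ∧ y ∈ S x then 0 else 1) =
        if i.1 < N x then (1 - ∑ y ∈ S x, M y) else 1 := by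
      intro i
      split_ifs with hi
      · have : ∀ y, (M y * if i.1 < N x ∧ y ∈ S x then 0 else 1) = M y - if y ∈ S x then M y else 0 := by
          intro y
          by_cases hy : y ∈ S x <;> simp [hi, hy]
        simp_rw [this]
        rw [Finset.sum_sub_distrib, hM1, Finset.sum_ite_mem, Finset.univ_inter]
      · simp [hi, hM1]
    simp_rw [h3]
    rw [Finset.prod_ite, Finset.prod_const, Finset.prod_const_one, mul_one]
    congr 1
    rw [Fin.card_filter_val_lt]
    exact min_eq_right (hNT x)
  have e2 : (1 : ℝ) ≤ ∑ x, (1 - ∑ y ∈ S x, M y) ^ (N x) := by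
    simp_rw [← e1]
    rw [Finset.sum_comm]
    calc (1 : ℝ) = ∑ u : Fin T → Y, ∏ i, M (u i) := by
          rw [← Fintype.sum_pow, hM1, one_pow]
      _ ≤ _ := by
          apply Finset.sum_le_sum
          intro u _
          obtain ⟨x, hx⟩ := hcon u
          have : ∏ i, M (u i) = ∏ i, (M (u i) * if i.1 < N x ∧ u i ∈ S x then 0 else 1) := by
            apply Finset.prod_congr rfl
            intro i _
            by_cases hi : i.1 < N x
            · simp [hx i hi]
            · simp [hi]
          rw [this]
          apply Finset.single_le_sum (f := fun x => ∏ i, (M (u i) * if i.1 < N x ∧ u i ∈ S x then 0 else 1)) _ (Finset.mem_univ x)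
          intro x _
          apply Finset.prod_nonneg
          intro i _
          have := hM0 (u i)
          split_ifs <;> simp [this]
  linarith

/-- Elias-type prefix code for the natural numbers. -/
def elias (i : ℕ) : List Bool :=
  List.replicate (i.size.size) true ++ false :: (i.size.bits ++ i.bits)

theorem unary_prefix (a b : ℕ) (u v : List Bool)
    (h : List.replicate a true ++ false :: u <+: List.replicate b true ++ false :: v) :
    a = b ∧ u <+: v := by
  induction a generalizing b with
  | zero =>
    cases b with
    | zero => simpa using h
    | succ b => simp [List.replicate_succ] at h
  | succ a ih =>
    cases b with
    | zero => simp [List.replicate_succ] at h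
    | succ b =>
      simp only [List.replicate_succ, List.cons_append, List.cons_prefix_cons, true_and] at h
      obtain ⟨h1, h2⟩ := ih b h
      exact ⟨by rw [h1], h2⟩

theorem bits_inj (a b : ℕ) (h : a.bits = b.bits) : a = b := by
  apply Nat.eq_of_testBit_eq
  intro i
  rw [Nat.testBit_eq_inth, Nat.testBit_eq_inth, h]

theorem prefix_append_len {a b u v : List Bool} (h : a ++ u <+: b ++ v) (hl : a.length = b.length) :
    a = b ∧ u <+: v := by
  have h1 : a = b := by
    have ha : a <+: b ++ v := (List.prefix_append a u).trans h
    have hb : b <+: b ++ v := List.prefix_append b v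
    exact (List.prefix_of_prefix_length_le ha hb hl.le).eq_of_length hl
  subst h1
  exact ⟨rfl, (List.prefix_append_right_inj a).1 h⟩

theorem elias_prefix (i j : ℕ) (h : elias i <+: elias j) : i = j := by
  obtain ⟨h1, h2⟩ := unary_prefix _ _ _ _ h
  obtain ⟨h3, h4⟩ := prefix_append_len h2 (by rw [Nat.size_eq_bits_len, Nat.size_eq_bits_len]; exact h1)
  have h5 := bits_inj _ _ h3
  exact bits_inj _ _ (h4.eq_of_length (by rw [Nat.size_eq_bits_len, Nat.size_eq_bits_len]; exact h5))

theorem elias_length (i : ℕ) : (elias i).length = 2 * i.size.size + 1 + i.size := by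
  unfold elias
  simp only [List.length_append, List.length_replicate, List.length_cons, Nat.size_eq_bits_len]
  omega

theorem size_log (m : ℕ) (hm : 0 < m) : Real.log 2 * m.size ≤ Real.log 2 + Real.log m := by
  have h1 : 2 ^ (m.size - 1) ≤ m := Nat.lt_size.1 (Nat.sub_lt (Nat.size_pos.2 hm) one_pos)
  have h2 : ((2:ℝ) ^ (m.size - 1)) ≤ m := by exact_mod_cast h1
  have h3 := Real.log_le_log (by positivity) h2
  rw [Real.log_pow] at h3
  have h4 : 1 ≤ m.size := Nat.size_pos.2 hm
  push_cast [h4] at h3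
  linarith

theorem pair_sum {A B : Type*} [Fintype A] [Fintype B] [DecidableEq A] [DecidableEq B] (n : ℕ)
    (F : (Fin n → A × B) → ℝ) :
    ∑ x : Fin n → A, ∑ y : Fin n → B, F (fun i => (x i, y i)) = ∑ z, F z := by
  rw [← Fintype.sum_prod_type']
  exact Fintype.sum_equiv (Equiv.arrowProdEquivProdArrow (Fin n) (fun _ => A) (fun _ => B)).symm _ _
    (fun z => rfl)

theorem exists_univ (n K : ℕ) (hK : 0 < K) :
    ∃ M : (Fin n → Fin K) → ℝ, (∀ y, 0 < M y) ∧ ∑ y, M y = 1 ∧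
      ∀ q : Fin K → ℝ, IsProb q → ∀ y, ∏ i, q (y i) ≤ ((n : ℝ) + 1) ^ K * M y := by
  classical
  let cnt : (Fin n → Fin K) → (Fin K → Fin (n + 1)) := fun y k =>
    ⟨(Finset.univ.filter fun i => y i = k).card,
      Nat.lt_succ_of_le ((Finset.card_le_univ _).trans (by simp))⟩
  let I := Finset.univ.image cnt
  let c : (Fin K → Fin (n + 1)) → ℕ := fun t => (Finset.univ.filter fun y => cnt y = t).card
  have hcpos : ∀ y, 0 < c (cnt y) := fun y => Finset.card_pos.2 ⟨y, by simp⟩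
  have hI : 0 < I.card := Finset.card_pos.2 ⟨cnt (fun _ => ⟨0, hK⟩), by simp [I]⟩
  have hI2 : (I.card : ℝ) ≤ ((n : ℝ) + 1) ^ K := by
    have : I.card ≤ (n + 1) ^ K := (Finset.card_le_univ _).trans (by simp)
    exact_mod_cast this
  have hIr : (0 : ℝ) < I.card := by exact_mod_cast hI
  refine ⟨fun y => 1 / (I.card * c (cnt y)), ?_, ?_, ?_⟩
  · intro y
    have := hcpos y
    positivity
  · rw [← Finset.sum_fiberwise_of_maps_to (s := Finset.univ) (t := I) (g := cnt)
      (fun y _ => Finset.mem_image_of_mem _ (Finset.mem_univ y))]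
    have : ∀ t ∈ I, ∑ y with cnt y = t, (1 : ℝ) / (I.card * c (cnt y)) = 1 / I.card := by
      intro t ht
      obtain ⟨y0, _, hy0⟩ := Finset.mem_image.1 ht
      have h1 : ∑ y with cnt y = t, (1 : ℝ) / (I.card * c (cnt y)) =
          ∑ y with cnt y = t, (1 : ℝ) / (I.card * c t) :=
        Finset.sum_congr rfl (fun y hy => by rw [(Finset.mem_filter.1 hy).2])
      rw [h1, Finset.sum_const, nsmul_eq_mul]
      have h2 : (0 : ℝ) < c t := by rw [← hy0]; exact_mod_cast hcpos y0
      change (c t : ℝ) * _ = _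
      field_simp
    rw [Finset.sum_congr rfl this, Finset.sum_const, nsmul_eq_mul]
    field_simp
  · intro q hq y
    have hprod : ∀ y : Fin n → Fin K, ∏ i, q (y i) = ∏ k, q k ^ (cnt y k).1 := by
      intro y
      rw [← Finset.prod_fiberwise' Finset.univ y q]
      simp [cnt]
    have h1 : (c (cnt y) : ℝ) * ∏ i, q (y i) ≤ 1 := by
      calc (c (cnt y) : ℝ) * ∏ i, q (y i) = ∑ y' with cnt y' = cnt y, ∏ i, q (y' i) := by
            rw [Finset.sum_congr rfl (g := fun _ => ∏ i, q (y i)), Finset.sum_const, nsmul_eq_mul]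
            intro y' hy'
            rw [hprod, hprod, (Finset.mem_filter.1 hy').2]
        _ ≤ ∑ y' : Fin n → Fin K, ∏ i, q (y' i) :=
            Finset.sum_le_sum_of_subset_of_nonneg (Finset.filter_subset _ _)
              (fun y' _ _ => Finset.prod_nonneg fun i _ => hq.1 _)
        _ = 1 := by rw [← Fintype.sum_pow, hq.2, one_pow]
    have h2 : (0 : ℝ) < c (cnt y) := by exact_mod_cast hcpos y
    calc ∏ i, q (y i) ≤ 1 / c (cnt y) := by rw [le_div_iff₀ h2]; linarith
      _ = I.card * (1 / (I.card * c (cnt y))) := by field_simp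
      _ ≤ _ := by gcongr

theorem tail_bound {A B : Type*} [Fintype A] [Fintype B] [DecidableEq A] [DecidableEq B] (n : ℕ)
    (hn : 0 < n) (p : A → ℝ) (Q : A → B → ℝ) (ρ : A → B → ℝ) (hp : IsProb p)
    (hQ : IsCondProb Q) (ρmax : ℝ) (hρ : ∀ j k, 0 ≤ ρ j k ∧ ρ j k ≤ ρmax) (s d D : ℝ) (hs : 0 ≤ s)
    (hs1 : s * ρmax ≤ 1) (hD : avgDist p Q ρ ≤ D) :
    ∑ x : Fin n → A, ∑ y : Fin n → B, prodProb p x * (∏ i, Q (x i) (y i)) *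
      (if nDist ρ x y ≤ d then 0 else 1) ≤ Real.exp (n * (s * (D - d) + s ^ 2 * ρmax ^ 2)) := by
  have hnr : (0 : ℝ) < n := by exact_mod_cast hn
  have hpt : ∀ (x : Fin n → A) (y : Fin n → B), prodProb p x * (∏ i, Q (x i) (y i)) *
      (if nDist ρ x y ≤ d then 0 else 1) ≤
      Real.exp (- (n * s * d)) *
        ∏ i, (p (x i) * Q (x i) (y i) * Real.exp (s * ρ (x i) (y i))) := by
    intro x y
    have h0 : 0 ≤ prodProb p x * (∏ i, Q (x i) (y i)) :=
      mul_nonneg (Finset.prod_nonneg fun i _ => hp.1 _) (Finset.prod_nonneg fun i _ => (hQ _).1 _)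
    have h1 : (if nDist ρ x y ≤ d then (0:ℝ) else 1) ≤
        Real.exp (- (n * s * d)) * ∏ i, Real.exp (s * ρ (x i) (y i)) := by
      rw [← Real.exp_sum, ← Real.exp_add]
      split_ifs with h
      · positivity
      · apply Real.one_le_exp
        rw [not_le, nDist, lt_div_iff₀ hnr] at h
        rw [← Finset.mul_sum]
        nlinarith
    calc _ ≤ prodProb p x * (∏ i, Q (x i) (y i)) *
          (Real.exp (- (n * s * d)) * ∏ i, Real.exp (s * ρ (x i) (y i))) :=
          mul_le_mul_of_nonneg_left h1 h0
      _ = _ := by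
          rw [Finset.prod_mul_distrib, Finset.prod_mul_distrib, prodProb]; ring
  have hmgf : ∑ z : A × B, p z.1 * Q z.1 z.2 * Real.exp (s * ρ z.1 z.2) ≤
      Real.exp (s * D + s ^ 2 * ρmax ^ 2) := by
    rw [Fintype.sum_prod_type]
    have hb : ∀ j k, p j * Q j k * Real.exp (s * ρ j k) ≤
        p j * Q j k * (1 + s ^ 2 * ρmax ^ 2) + s * (p j * Q j k * ρ j k) := by
      intro j k
      obtain ⟨h1, h2⟩ := hρ j k
      have h3 : 0 ≤ s * ρ j k := mul_nonneg hs h1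
      have h4 : s * ρ j k ≤ s * ρmax := mul_le_mul_of_nonneg_left h2 hs
      have h5 := Real.abs_exp_sub_one_sub_id_le (x := s * ρ j k)
        (by rw [abs_of_nonneg h3]; linarith)
      have h6 := (abs_le.1 h5).2
      have h7 : (s * ρ j k) ^ 2 ≤ s ^ 2 * ρmax ^ 2 := by
        rw [← mul_pow]; exact pow_le_pow_left₀ h3 h4 2
      have h8 : 0 ≤ p j * Q j k := mul_nonneg (hp.1 _) ((hQ _).1 _)
      have h9 : Real.exp (s * ρ j k) ≤ 1 + s ^ 2 * ρmax ^ 2 + s * ρ j k := by linarith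
      calc _ ≤ p j * Q j k * (1 + s ^ 2 * ρmax ^ 2 + s * ρ j k) := mul_le_mul_of_nonneg_left h9 h8
        _ = _ := by ring
    have hone : ∑ j, ∑ k, p j * Q j k = 1 := by
      simp_rw [← Finset.mul_sum, (hQ _).2, mul_one, hp.2]
    calc ∑ j, ∑ k, p j * Q j k * Real.exp (s * ρ j k)
        ≤ ∑ j, ∑ k, (p j * Q j k * (1 + s ^ 2 * ρmax ^ 2) + s * (p j * Q j k * ρ j k)) :=
          Finset.sum_le_sum fun j _ => Finset.sum_le_sum fun k _ => hb j k
      _ = (1 + s ^ 2 * ρmax ^ 2) + s * avgDist p Q ρ := by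
          simp_rw [Finset.sum_add_distrib, ← Finset.sum_mul, ← Finset.mul_sum]
          rw [avgDist]
          simp_rw [(hQ _).2, mul_one, hp.2, one_mul]
      _ ≤ (s * D + s ^ 2 * ρmax ^ 2) + 1 := by
          have := mul_le_mul_of_nonneg_left hD hs
          linarith
      _ ≤ _ := Real.add_one_le_exp _
  calc _ ≤ ∑ x : Fin n → A, ∑ y : Fin n → B, Real.exp (- (n * s * d)) *
        ∏ i, (p (x i) * Q (x i) (y i) * Real.exp (s * ρ (x i) (y i))) :=
        Finset.sum_le_sum fun x _ => Finset.sum_le_sum fun y _ => hpt x y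
    _ = Real.exp (- (n * s * d)) *
        (∑ z : A × B, p z.1 * Q z.1 z.2 * Real.exp (s * ρ z.1 z.2)) ^ n := by
        simp_rw [← Finset.mul_sum]
        congr 1
        rw [Fintype.sum_pow]
        exact pair_sum n (fun z => ∏ i, (p (z i).1 * Q (z i).1 (z i).2 *
          Real.exp (s * ρ (z i).1 (z i).2)))
    _ ≤ Real.exp (- (n * s * d)) * (Real.exp (s * D + s ^ 2 * ρmax ^ 2)) ^ n := by
        gcongr
        exact Finset.sum_nonneg fun z _ => mul_nonneg
          (mul_nonneg (hp.1 _) ((hQ _).1 _)) (Real.exp_pos _).le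
    _ = _ := by
        rw [← Real.exp_nat_mul, ← Real.exp_add]
        congr 1
        ring

theorem marg_zero {A B : Type*} [Fintype A] [Fintype B] (p : A → ℝ) (Q : A → B → ℝ)
    (hp : IsProb p) (hQ : IsCondProb Q) (j : A) (k : B) (hj : 0 < p j)
    (h : ∑ j', p j' * Q j' k = 0) : Q j k = 0 := by
  have := (Finset.sum_eq_zero_iff_of_nonneg
    (fun j' _ => mul_nonneg (hp.1 j') ((hQ j').1 k))).1 h j (Finset.mem_univ j)
  rcases mul_eq_zero.1 this with h | h
  · linarith
  · exact h

theorem mutualInfo_nonneg' {A B : Type*} [Fintype A] [Fintype B] (p : A → ℝ) (Q : A → B → ℝ)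
    (hp : IsProb p) (hQ : IsCondProb Q) : 0 ≤ mutualInfo p Q := by
  have hpt : ∀ j k, p j * Q j k - p j * ∑ j', p j' * Q j' k ≤
      p j * Q j k * Real.log (Q j k / ∑ j', p j' * Q j' k) := by
    intro j k
    rcases (hp.1 j).eq_or_lt with h | h
    · simp [← h]
    · have hq : 0 ≤ ∑ j', p j' * Q j' k :=
        Finset.sum_nonneg fun j' _ => mul_nonneg (hp.1 j') ((hQ j').1 k)
      rcases hq.eq_or_lt with h0 | h0
      · rw [marg_zero p Q hp hQ j k h h0.symm, ← h0]; simp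
      · have := mul_le_mul_of_nonneg_left (kl_ge (Q j k) _ ((hQ j).1 k) h0) h.le
        linarith
  calc 0 = ∑ j, ∑ k, (p j * Q j k - p j * ∑ j', p j' * Q j' k) := by
        simp_rw [Finset.sum_sub_distrib, ← Finset.mul_sum]
        rw [Finset.sum_comm]
        simp_rw [← Finset.mul_sum, (hQ _).2, mul_one, ← Finset.sum_mul, hp.2]
        simp
    _ ≤ _ := Finset.sum_le_sum fun j _ => Finset.sum_le_sum fun k _ => hpt j k

theorem mix_info {A : Type*} [Fintype A] (K : ℕ) (hK : 0 < K) (p : A → ℝ) (Q Q0 : A → Fin K → ℝ)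
    (hp : IsProb p) (hQ : IsCondProb Q) (hQ0 : IsCondProb Q0) (l : ℝ) (hl : 0 < l) (hl1 : l < 1) :
    ∑ j, ∑ k, p j * ((1 - l) * Q j k + l * Q0 j k) *
      Real.log (((1 - l) * Q j k + l * Q0 j k) / ((1 - l) * (∑ j', p j' * Q j' k) + l * (1 / K)))
      ≤ mutualInfo p Q + l * Real.log K := by
  have hKr : (0 : ℝ) < K := by exact_mod_cast hK
  have hK1 : (1 : ℝ) ≤ K := by exact_mod_cast hK
  have hl' : 0 < 1 - l := by linarith
  have hpt : ∀ j k, p j * ((1 - l) * Q j k + l * Q0 j k) *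
      Real.log (((1 - l) * Q j k + l * Q0 j k) / ((1 - l) * (∑ j', p j' * Q j' k) + l * (1 / K)))
      ≤ (1 - l) * (p j * Q j k * Real.log (Q j k / ∑ j', p j' * Q j' k)) +
        l * Real.log K * (p j * Q0 j k) := by
    intro j k
    rcases (hp.1 j).eq_or_lt with h | h
    · simp [← h]
    have hq : 0 ≤ ∑ j', p j' * Q j' k :=
        Finset.sum_nonneg fun j' _ => mul_nonneg (hp.1 j') ((hQ j').1 k)
    have h1 := log_sum2 ((1 - l) * Q j k) (l * Q0 j k) ((1 - l) * (∑ j', p j' * Q j' k)) (l * (1 / K))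
      (mul_nonneg hl'.le ((hQ j).1 k)) (mul_nonneg hl.le ((hQ0 j).1 k)) (mul_nonneg hl'.le hq)
      (by positivity) (by
        intro h0
        rcases mul_eq_zero.1 h0 with h0 | h0
        · linarith
        · rw [marg_zero p Q hp hQ j k h h0, mul_zero])
    rw [mul_div_mul_left _ _ hl'.ne', mul_div_mul_left _ _ hl.ne'] at h1
    have h2 : Q0 j k * Real.log (Q0 j k / (1 / K)) ≤ Q0 j k * Real.log K := by
      rcases ((hQ0 j).1 k).eq_or_lt with h0 | h0
      · simp [← h0]
      · apply mul_le_mul_of_nonneg_left _ h0.le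
        apply Real.log_le_log (by positivity)
        have : Q0 j k ≤ 1 := by
          rw [← (hQ0 j).2]
          exact Finset.single_le_sum (f := fun k => Q0 j k) (fun k _ => (hQ0 j).1 k) (Finset.mem_univ k)
        rw [div_div_eq_mul_div, div_one]
        nlinarith
    have h3 := mul_le_mul_of_nonneg_left h1 h.le
    have h4 := mul_le_mul_of_nonneg_left h2 (mul_nonneg h.le hl.le)
    linarith
  calc _ ≤ ∑ j, ∑ k, ((1 - l) * (p j * Q j k * Real.log (Q j k / ∑ j', p j' * Q j' k)) +
        l * Real.log K * (p j * Q0 j k)) :=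
        Finset.sum_le_sum fun j _ => Finset.sum_le_sum fun k _ => hpt j k
    _ = (1 - l) * mutualInfo p Q + l * Real.log K := by
        simp_rw [Finset.sum_add_distrib, ← Finset.mul_sum, (hQ0 _).2, mul_one, hp.2, mul_one]
        rfl
    _ ≤ _ := by
        have := mutualInfo_nonneg' p Q hp hQ
        nlinarith

theorem kl_prod {A : Type*} [Fintype A] [DecidableEq A] (n K : ℕ) (p : A → ℝ)
    (Q : A → Fin K → ℝ) (hp : IsProb p) (hQ : IsCondProb Q) (q : Fin K → ℝ) (hq : ∀ k, 0 < q k)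
    (M : (Fin n → Fin K) → ℝ) (hM : ∀ y, 0 < M y)
    (hqM : ∀ y, ∏ i, q (y i) ≤ ((n : ℝ) + 1) ^ K * M y) :
    ∑ x : Fin n → A, prodProb p x * ∑ y : Fin n → Fin K, (∏ i, Q (x i) (y i)) *
      Real.log ((∏ i, Q (x i) (y i)) / M y) ≤
      n * (∑ j, ∑ k, p j * Q j k * Real.log (Q j k / q k)) + K * Real.log (n + 1) := by
  have hpx : ∀ x : Fin n → A, 0 ≤ prodProb p x := fun x => Finset.prod_nonneg fun i _ => hp.1 _
  have hpt : ∀ (x : Fin n → A) (y : Fin n → Fin K), (∏ i, Q (x i) (y i)) *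
      Real.log ((∏ i, Q (x i) (y i)) / M y) ≤ (∏ i, Q (x i) (y i)) *
      (∑ i, Real.log (Q (x i) (y i) / q (y i))) + (∏ i, Q (x i) (y i)) * (K * Real.log (n + 1)) := by
    intro x y
    have hW : 0 ≤ ∏ i, Q (x i) (y i) := Finset.prod_nonneg fun i _ => (hQ _).1 _
    rcases hW.eq_or_lt with h | h
    · simp [← h]
    · rw [← mul_add]
      apply mul_le_mul_of_nonneg_left _ hW
      have hne : ∀ i, Q (x i) (y i) ≠ 0 := fun i => (Finset.prod_ne_zero_iff.1 h.ne') i (Finset.mem_univ i)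
      have hqp : 0 < ∏ i, q (y i) := Finset.prod_pos fun i _ => hq _
      have hMy := hM y
      rw [← Real.log_prod (fun i _ => div_ne_zero (hne i) (hq _).ne'), Finset.prod_div_distrib,
        ← Real.log_pow, ← Real.log_mul (by positivity) (by positivity)]
      apply Real.log_le_log (by positivity)
      rw [div_mul_eq_mul_div, div_le_div_iff₀ hMy hqp]
      have := mul_le_mul_of_nonneg_left (hqM y) hW
      linarith
  have h1 : ∑ x : Fin n → A, prodProb p x * ∑ y : Fin n → Fin K, (∏ i, Q (x i) (y i)) *
      (∑ i, Real.log (Q (x i) (y i) / q (y i))) =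
      n * (∑ j, ∑ k, p j * Q j k * Real.log (Q j k / q k)) := by
    have h := sum_prod_mul_sum n (fun z : A × Fin K => p z.1 * Q z.1 z.2)
      (fun z => Real.log (Q z.1 z.2 / q z.2))
      (by rw [Fintype.sum_prod_type]; simp_rw [← Finset.mul_sum, (hQ _).2, mul_one, hp.2])
    rw [Fintype.sum_prod_type] at h
    rw [← h, ← pair_sum n]
    apply Finset.sum_congr rfl
    intro x _
    rw [Finset.mul_sum]
    apply Finset.sum_congr rfl
    intro y _
    rw [Finset.prod_mul_distrib, prodProb]
    ring
  have hW1 : ∀ x : Fin n → A, ∑ y : Fin n → Fin K, ∏ i, Q (x i) (y i) = 1 := by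
    intro x
    have h2 := Finset.prod_univ_sum (fun _ : Fin n => (Finset.univ : Finset (Fin K)))
      (fun i y => Q (x i) y)
    rw [Fintype.piFinset_univ] at h2
    rw [← h2]
    simp [(hQ _).2]
  have hp1 : ∑ x : Fin n → A, prodProb p x = 1 := by
    unfold prodProb
    rw [← Fintype.sum_pow, hp.2, one_pow]
  calc _ ≤ ∑ x : Fin n → A, prodProb p x * ∑ y : Fin n → Fin K, ((∏ i, Q (x i) (y i)) *
      (∑ i, Real.log (Q (x i) (y i) / q (y i))) + (∏ i, Q (x i) (y i)) * (K * Real.log (n + 1))) := by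
        apply Finset.sum_le_sum
        intro x _
        exact mul_le_mul_of_nonneg_left (Finset.sum_le_sum fun y _ => hpt x y) (hpx x)
    _ = _ := by
        simp_rw [Finset.sum_add_distrib, mul_add, Finset.sum_add_distrib, h1, ← Finset.sum_mul, hW1,
          one_mul, ← Finset.sum_mul, hp1, one_mul]

theorem exp_bound (J n K : ℕ) (p : Fin J → ℝ)
    (Q : Fin J → Fin K → ℝ) (hp : IsProb p) (hQ : IsCondProb Q) (q : Fin K → ℝ) (hq : ∀ k, 0 < q k)
    (M : (Fin n → Fin K) → ℝ) (hM : ∀ y, 0 < M y) (hM1 : ∑ y, M y = 1)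
    (hqM : ∀ y, ∏ i, q (y i) ≤ ((n : ℝ) + 1) ^ K * M y)
    (ρ : Fin J → Fin K → ℝ) (d : ℝ) (S : (Fin n → Fin J) → Finset (Fin n → Fin K))
    (hS : ∀ x y, y ∈ S x ↔ nDist ρ x y ≤ d) (hSp : ∀ x, 0 < ∑ y ∈ S x, M y) (Amax : ℝ)
    (hA : ∀ x, - Real.log (∑ y ∈ S x, M y) ≤ Amax) (hA0 : 0 ≤ Amax) (ε : ℝ)
    (hε : ∑ x : Fin n → Fin J, ∑ y : Fin n → Fin K, prodProb p x * (∏ i, Q (x i) (y i)) *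
      (if nDist ρ x y ≤ d then 0 else 1) ≤ ε) :
    ∑ x : Fin n → Fin J, prodProb p x * (- Real.log (∑ y ∈ S x, M y)) ≤
      n * (∑ j, ∑ k, p j * Q j k * Real.log (Q j k / q k)) + K * Real.log (n + 1) + Real.log 2 +
        ε * Amax := by
  have hpx : ∀ x : Fin n → Fin J, 0 ≤ prodProb p x := fun x => Finset.prod_nonneg fun i _ => hp.1 _
  have hW1 : ∀ x : Fin n → Fin J, ∑ y : Fin n → Fin K, ∏ i, Q (x i) (y i) = 1 := by
    intro x
    have h2 := Finset.prod_univ_sum (fun _ : Fin n => (Finset.univ : Finset (Fin K)))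
      (fun i y => Q (x i) y)
    rw [Fintype.piFinset_univ] at h2
    rw [← h2]
    simp [(hQ _).2]
  have hp1 : ∑ x : Fin n → Fin J, prodProb p x = 1 := by
    unfold prodProb
    rw [← Fintype.sum_pow, hp.2, one_pow]
  have hpt : ∀ x : Fin n → Fin J, prodProb p x * (- Real.log (∑ y ∈ S x, M y)) ≤
      prodProb p x * (∑ y : Fin n → Fin K, (∏ i, Q (x i) (y i)) *
        Real.log ((∏ i, Q (x i) (y i)) / M y)) + prodProb p x * Real.log 2 +
      (∑ y : Fin n → Fin K, prodProb p x * (∏ i, Q (x i) (y i)) *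
      (if nDist ρ x y ≤ d then 0 else 1)) * Amax := by
    intro x
    have hdv := dv_bound (fun y : Fin n → Fin K => ∏ i, Q (x i) (y i)) M
      (fun y => Finset.prod_nonneg fun i _ => (hQ _).1 _) (hW1 x) hM hM1 (S x) (hSp x)
    have hbad : ∑ y : Fin n → Fin K, prodProb p x * (∏ i, Q (x i) (y i)) *
      (if nDist ρ x y ≤ d then (0:ℝ) else 1) =
        prodProb p x * (1 - ∑ y ∈ S x, ∏ i, Q (x i) (y i)) := by
      rw [← hW1 x]
      simp_rw [mul_assoc, ← Finset.mul_sum]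
      congr 1
      have h1 : ∑ y ∈ S x, ∏ i, Q (x i) (y i) =
          ∑ y, if y ∈ S x then ∏ i, Q (x i) (y i) else 0 := by
        rw [Finset.sum_ite_mem, Finset.univ_inter]
      rw [h1, ← Finset.sum_sub_distrib]
      apply Finset.sum_congr rfl
      intro y _
      simp only [hS]
      split_ifs <;> simp [hW1]
    rw [hbad, mul_assoc, ← mul_add, ← mul_add]
    apply mul_le_mul_of_nonneg_left _ (hpx x)
    have hle : ∑ y ∈ S x, ∏ i, Q (x i) (y i) ≤ 1 := by
      rw [← hW1 x]
      exact Finset.sum_le_sum_of_subset_of_nonneg (Finset.subset_univ _)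
        (fun y _ _ => Finset.prod_nonneg fun i _ => (hQ _).1 _)
    have := mul_le_mul_of_nonneg_left (hA x) (sub_nonneg.2 hle)
    linarith
  have hsum := Finset.sum_le_sum (fun x (_ : x ∈ Finset.univ) => hpt x)
  rw [Finset.sum_add_distrib, Finset.sum_add_distrib, ← Finset.sum_mul, ← Finset.sum_mul, hp1] at hsum
  have hk := kl_prod n K p Q hp hQ q hq M hM hqM
  have he := mul_le_mul_of_nonneg_right hε hA0
  linarith

theorem exists_code (J K n : ℕ) (hJ : 0 < J) (hn : 0 < n) (M : (Fin n → Fin K) → ℝ)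
    (hM : ∀ y, 0 < M y)
    (hM1 : ∑ y, M y = 1) (S : (Fin n → Fin J) → Finset (Fin n → Fin K))
    (hSp : ∀ x, 0 < ∑ y ∈ S x, M y) :
    ∃ (φ : (Fin n → Fin J) → (Fin n → Fin K)) (f : (Fin n → Fin K) → List Bool)
      (g : List Bool → (Fin n → Fin K)),
      (∀ x, φ x ∈ S x) ∧ (∀ x, g (f (φ x)) = φ x) ∧
      (∀ x₁ x₂, f (φ x₁) <+: f (φ x₂) → f (φ x₁) = f (φ x₂)) ∧
      ∀ x, ∃ N : ℕ, 0 < N ∧ (N : ℝ) ≤ 2 * (n * J) / (∑ y ∈ S x, M y) ∧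
        (f (φ x)).length ≤ 2 * N.size.size + 1 + N.size := by
  classical
  have hnr : (1 : ℝ) ≤ n := by exact_mod_cast hn
  have hJr : (1 : ℝ) ≤ J := by exact_mod_cast hJ
  have hμ1 : ∀ x, ∑ y ∈ S x, M y ≤ 1 := by
    intro x
    rw [← hM1]
    exact Finset.sum_le_sum_of_subset_of_nonneg (Finset.subset_univ _) (fun y _ _ => (hM y).le)
  set N : (Fin n → Fin J) → ℕ := fun x => ⌊(n * J : ℝ) / (∑ y ∈ S x, M y)⌋₊ + 1 with hN
  have hlt : ∑ x, (1 - ∑ y ∈ S x, M y) ^ (N x) < 1 := by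
    have hx : ∀ x, (1 - ∑ y ∈ S x, M y) ^ (N x) < Real.exp (- (n * J)) := by
      intro x
      set μ := ∑ y ∈ S x, M y with hμ
      have hμp : 0 < μ := hSp x
      have hμ1' : μ ≤ 1 := hμ1 x
      calc (1 - μ) ^ (N x) ≤ (Real.exp (-μ)) ^ (N x) := by
            apply pow_le_pow_left₀ (by linarith)
            have := Real.add_one_le_exp (-μ)
            linarith
        _ = Real.exp (- (N x * μ)) := by
            rw [← Real.exp_nat_mul]; congr 1; ring
        _ < _ := by
            apply Real.exp_lt_exp.2
            have h1 : (n * J : ℝ) / μ < N x := by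
              simp only [hN]
              push_cast
              exact Nat.lt_floor_add_one _
            rw [div_lt_iff₀ hμp] at h1
            linarith
    have hne : (Finset.univ : Finset (Fin n → Fin J)).Nonempty :=
      ⟨fun _ => ⟨0, hJ⟩, Finset.mem_univ _⟩
    calc ∑ x, (1 - ∑ y ∈ S x, M y) ^ (N x) < ∑ x : Fin n → Fin J, Real.exp (- (n * J)) :=
          Finset.sum_lt_sum_of_nonempty hne (fun x _ => hx x)
      _ = (J * Real.exp (-J)) ^ n := by
          simp only [Finset.sum_const, Finset.card_univ, Fintype.card_fun, Fintype.card_fin,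
            nsmul_eq_mul]
          push_cast
          rw [mul_pow, ← Real.exp_nat_mul]
          congr 2; ring
      _ ≤ 1 := by
          apply pow_le_one₀ (by positivity)
          rw [Real.exp_neg, ← div_eq_mul_inv, div_le_one (Real.exp_pos _)]
          have := Real.add_one_le_exp (J : ℝ)
          linarith
  obtain ⟨u, hu⟩ := exists_seq M (fun y => (hM y).le) hM1 S N hlt
  choose ix hix hixS using hu
  have hinj : Function.Injective elias := fun a b h => elias_prefix a b (by rw [h])
  let idx : (Fin n → Fin K) → ℕ := fun y => if h : ∃ i, u i = y then Nat.find h else 0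
  have hidx : ∀ i, u (idx (u i)) = u i ∧ idx (u i) ≤ i := by
    intro i
    have h : ∃ i', u i' = u i := ⟨i, rfl⟩
    simp only [idx, dif_pos h]
    exact ⟨Nat.find_spec h, Nat.find_min' h rfl⟩
  refine ⟨fun x => u (ix x), fun y => elias (idx y), fun l => u (Function.invFun elias l),
    hixS, ?_, ?_, ?_⟩
  · intro x
    simp only [Function.leftInverse_invFun hinj _]
    exact (hidx _).1
  · intro x₁ x₂ h
    exact congrArg elias (elias_prefix _ _ h)
  · intro x
    refine ⟨N x, Nat.succ_pos _, ?_, ?_⟩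
    · have h1 : ((⌊(n * J : ℝ) / (∑ y ∈ S x, M y)⌋₊ : ℕ) : ℝ) ≤ (n * J : ℝ) / (∑ y ∈ S x, M y) :=
        Nat.floor_le (div_nonneg (by positivity) (hSp x).le)
      have h2 : 1 ≤ (n * J : ℝ) / (∑ y ∈ S x, M y) := by
        rw [one_le_div (hSp x)]
        have := hμ1 x
        nlinarith
      have h3 : 2 * (n * J : ℝ) / (∑ y ∈ S x, M y) = 2 * ((n * J : ℝ) / (∑ y ∈ S x, M y)) :=
        mul_div_assoc _ _ _
      rw [h3]
      simp only [hN]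
      push_cast
      linarith
    · rw [elias_length]
      have h1 : idx (u (ix x)) ≤ N x := (hidx _).2.trans (hix x).le
      have h2 := Nat.size_le_size h1
      have h3 := Nat.size_le_size h2
      beta_reduce
      omega

theorem length_bound (n J K N l : ℕ) (hn : 0 < n) (hJ : 0 < J) (hK : 0 < K) (μ : ℝ) (hμ : 0 < μ)
    (hμA : - Real.log μ ≤ n * Real.log K + K * Real.log (n + 1)) (hN : 0 < N)
    (hN2 : (N : ℝ) ≤ 2 * (n * J) / μ) (hl : l ≤ 2 * N.size.size + 1 + N.size) :
    Real.log 2 * l ≤ - Real.log μ + (3 * Real.log n +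
      (5 * Real.log 2 + Real.log J + 2 * Real.log (2 * (2 + J + 2 * K)))) := by
  have hnr : (1 : ℝ) ≤ n := by exact_mod_cast hn
  have hJr : (1 : ℝ) ≤ J := by exact_mod_cast hJ
  have hKr : (1 : ℝ) ≤ K := by exact_mod_cast hK
  have hNr : (0 : ℝ) < N := by exact_mod_cast hN
  have hl2 : 0 < Real.log 2 := Real.log_pos (by norm_num)
  have h1 := size_log N hN
  have h2 : Real.log N ≤ Real.log 2 + Real.log n + Real.log J - Real.log μ := by
    have := Real.log_le_log hNr hN2
    rw [Real.log_div (by positivity) hμ.ne', Real.log_mul (by positivity) (by positivity),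
      Real.log_mul (by positivity) (by positivity)] at this
    linarith
  have hs : 0 < N.size := Nat.size_pos.2 hN
  have hsr : (0 : ℝ) < N.size := by exact_mod_cast hs
  have h3 := size_log N.size hs
  have h4 : (N.size : ℝ) ≤ n * (2 * (2 + J + 2 * K)) := by
    have a1 : Real.log n ≤ n - 1 := Real.log_le_sub_one_of_pos (by linarith)
    have a2 : Real.log J ≤ J - 1 := Real.log_le_sub_one_of_pos (by linarith)
    have a3 : Real.log K ≤ K - 1 := Real.log_le_sub_one_of_pos (by linarith)
    have a4 : Real.log ((n : ℝ) + 1) ≤ n + 1 - 1 := Real.log_le_sub_one_of_pos (by linarith)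
    have a5 : (n : ℝ) * Real.log K ≤ n * K := by
      apply mul_le_mul_of_nonneg_left _ (by linarith); linarith
    have a6 : (K : ℝ) * Real.log (n + 1) ≤ K * n := by
      apply mul_le_mul_of_nonneg_left _ (by linarith); linarith
    have a7 : (J : ℝ) ≤ n * J := by nlinarith
    have a8 : Real.log 2 < 1 := by linarith [Real.log_two_lt_d9]
    have a9 : 1 / 2 < Real.log 2 := by linarith [Real.log_two_gt_d9]
    have b1 : Real.log 2 * N.size ≤ n * (2 + J + 2 * K) := by nlinarith
    nlinarith
  have h5 : Real.log N.size ≤ Real.log n + Real.log (2 * (2 + J + 2 * K)) := by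
    have := Real.log_le_log hsr h4
    rwa [Real.log_mul (by positivity) (by positivity)] at this
  have h6 : (l : ℝ) ≤ 2 * N.size.size + 1 + N.size := by exact_mod_cast hl
  have h7 := mul_le_mul_of_nonneg_left h6 hl2.le
  nlinarith

theorem RD_nonpos_point (J K : ℕ) (ρ : Fin J → Fin K → ℝ) (d : ℝ) (hd : 0 ≤ d)
    (Q0 : Fin J → Fin K → ℝ) (hQ0 : IsCondProb Q0) (hz : ∀ j k, Q0 j k * ρ j k = 0) (a : Fin J) :
    RD (fun j => if j = a then 1 else 0) d ρ ≤ 0 := by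
  have hmem : (0 : ℝ) ∈ { r | ∃ Q, IsCondProb Q ∧
      avgDist (fun j => if j = a then (1:ℝ) else 0) Q ρ ≤ d ∧
      r = mutualInfo (fun j => if j = a then (1:ℝ) else 0) Q } := by
    refine ⟨Q0, hQ0, ?_, ?_⟩
    · unfold avgDist
      simp_rw [mul_assoc, hz]
      simpa using hd
    · unfold mutualInfo
      symm
      apply Finset.sum_eq_zero
      intro j _
      apply Finset.sum_eq_zero
      intro k _
      by_cases hj : j = a
      · subst hj
        simp only [ite_true, one_mul, ite_mul, zero_mul, Finset.sum_ite_eq', Finset.mem_univ]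
        by_cases h : Q0 j k = 0
        · simp [h]
        · simp [div_self h]
      · simp [hj]
  unfold RD
  by_cases hb : BddBelow { r | ∃ Q, IsCondProb Q ∧
      avgDist (fun j => if j = a then (1:ℝ) else 0) Q ρ ≤ d ∧
      r = mutualInfo (fun j => if j = a then (1:ℝ) else 0) Q }
  · exact csInf_le hb hmem
  · rw [Real.sInf_of_not_bddBelow hb]

theorem sup_nonneg (J K n : ℕ) (hJ : 0 < J) (ρ : Fin J → Fin K → ℝ) (d : ℝ) (hd : 0 ≤ d)
    (Q0 : Fin J → Fin K → ℝ) (hQ0 : IsCondProb Q0) (hz : ∀ j k, Q0 j k * ρ j k = 0)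
    (len : (Fin n → Fin J) → ℕ) :
    0 ≤ sSup { v : ℝ | ∃ p : Fin J → ℝ, IsProb p ∧
                  v = (Real.log 2 / n) *
                        (∑ x : Fin n → Fin J, prodProb p x * ((len x : ℕ) : ℝ))
                      - RD p d ρ } := by
  have hp : IsProb (fun j : Fin J => if j = ⟨0, hJ⟩ then (1:ℝ) else 0) := by
    refine ⟨fun a => ?_, by simp⟩
    dsimp only
    split_ifs <;> norm_num
  have hR := RD_nonpos_point J K ρ d hd Q0 hQ0 hz ⟨0, hJ⟩
  have h0 : 0 ≤ (Real.log 2 / n) * (∑ x : Fin n → Fin J,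
      prodProb (fun j : Fin J => if j = ⟨0, hJ⟩ then (1:ℝ) else 0) x * ((len x : ℕ) : ℝ)) := by
    apply mul_nonneg (div_nonneg (Real.log_nonneg (by norm_num)) (by positivity))
    exact Finset.sum_nonneg fun x _ => mul_nonneg (Finset.prod_nonneg fun i _ => hp.1 _) (by positivity)
  by_cases hb : BddAbove { v : ℝ | ∃ p : Fin J → ℝ, IsProb p ∧
                  v = (Real.log 2 / n) *
                        (∑ x : Fin n → Fin J, prodProb p x * ((len x : ℕ) : ℝ))
                      - RD p d ρ }
  · exact le_csSup_of_le hb ⟨_, hp, rfl⟩ (by linarith)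
  · rw [Real.sSup_of_not_bddAbove hb]

theorem redundancy (J K n : ℕ) (hJ : 0 < J) (hK : 0 < K) (hn : 0 < n)
    (ρmax : ℝ) (d : ℝ) (hd : 0 < d)
    (ρ : Fin J → Fin K → ℝ) (hρ : ∀ j k, 0 ≤ ρ j k ∧ ρ j k ≤ ρmax)
    (Q0 : Fin J → Fin K → ℝ) (hQ0 : IsCondProb Q0) (hz : ∀ j k, Q0 j k * ρ j k = 0)
    (s : ℝ) (hs : 0 ≤ s) (hs1 : s * ρmax ≤ 1) (hs2 : s ^ 2 * n = Real.log n)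
    (l : ℝ) (hl : 0 < l) (hl1 : l < 1) (hls : l * d = (1 + ρmax ^ 2) * s) :
    ∃ (φ : (Fin n → Fin J) → (Fin n → Fin K)) (f : (Fin n → Fin K) → List Bool)
      (g : List Bool → (Fin n → Fin K)),
      (∀ x, nDist ρ x (φ x) ≤ d) ∧ (∀ x, g (f (φ x)) = φ x) ∧
      (∀ x₁ x₂, f (φ x₁) <+: f (φ x₂) → f (φ x₁) = f (φ x₂)) ∧
      ∀ p, IsProb p → Real.log 2 * (∑ x : Fin n → Fin J, prodProb p x * ((f (φ x)).length : ℝ)) ≤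
        n * RD p d ρ + n * l * Real.log K + K * Real.log (n + 1) + Real.log 2 +
        1 / n * (n * Real.log K + K * Real.log (n + 1)) + (3 * Real.log n +
      (5 * Real.log 2 + Real.log J + 2 * Real.log (2 * (2 + J + 2 * K)))) := by
  classical
  have hnr : (0 : ℝ) < n := by exact_mod_cast hn
  have hKr : (0 : ℝ) < K := by exact_mod_cast hK
  have hK1 : (1 : ℝ) ≤ K := by exact_mod_cast hK
  obtain ⟨M, hM, hM1, hMq⟩ := exists_univ n K hK
  let S : (Fin n → Fin J) → Finset (Fin n → Fin K) := fun x =>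
    Finset.univ.filter fun y => nDist ρ x y ≤ d
  have hS : ∀ x y, y ∈ S x ↔ nDist ρ x y ≤ d := fun x y => by simp [S]
  -- a zero-distortion letter for each source letter
  have hzero : ∀ j, ∃ k, ρ j k = 0 := by
    intro j
    by_contra! hcon
    have : ∀ k, Q0 j k = 0 := fun k => (mul_eq_zero.1 (hz j k)).resolve_right (hcon k)
    have h1 := (hQ0 j).2
    simp [this] at h1
  choose z hzρ using hzero
  have hunif : IsProb (fun _ : Fin K => 1 / (K : ℝ)) := by
    refine ⟨fun _ => by positivity, ?_⟩
    simp; field_simp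
  have hlow : ∀ x, 1 / ((K : ℝ) ^ n * ((n : ℝ) + 1) ^ K) ≤ ∑ y ∈ S x, M y := by
    intro x
    have hy : (fun i => z (x i)) ∈ S x := by
      rw [hS]
      simp [nDist, hzρ, hd.le]
    have h1 : M (fun i => z (x i)) ≤ ∑ y ∈ S x, M y :=
      Finset.single_le_sum (f := M) (fun y _ => (hM y).le) hy
    refine le_trans ?_ h1
    have h2 := hMq _ hunif (fun i => z (x i))
    simp only [Finset.prod_const, Finset.card_univ, Fintype.card_fin] at h2
    rw [div_le_iff₀ (by positivity)]
    rw [one_div, inv_pow, inv_le_iff_one_le_mul₀ (by positivity)] at h2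
    linarith
  have hSp : ∀ x, 0 < ∑ y ∈ S x, M y := fun x => lt_of_lt_of_le (by positivity) (hlow x)
  have hA : ∀ x, - Real.log (∑ y ∈ S x, M y) ≤ n * Real.log K + K * Real.log (n + 1) := by
    intro x
    have := Real.log_le_log (by positivity) (hlow x)
    rw [one_div, Real.log_inv, Real.log_mul (by positivity) (by positivity), Real.log_pow,
      Real.log_pow] at this
    linarith
  have hlogK : 0 ≤ Real.log K := Real.log_nonneg hK1
  have hlogn : 0 ≤ Real.log ((n : ℝ) + 1) := Real.log_nonneg (by linarith)
  obtain ⟨φ, f, g, h1, h2, h3, h4⟩ := exists_code J K n hJ hn M hM hM1 S hSp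
  refine ⟨φ, f, g, fun x => (hS x _).1 (h1 x), h2, h3, ?_⟩
  intro p hp
  have hpx : ∀ x : Fin n → Fin J, 0 ≤ prodProb p x := fun x => Finset.prod_nonneg fun i _ => hp.1 _
  have hp1 : ∑ x : Fin n → Fin J, prodProb p x = 1 := by
    unfold prodProb
    rw [← Fintype.sum_pow, hp.2, one_pow]
  set C := (3 * Real.log n +
      (5 * Real.log 2 + Real.log J + 2 * Real.log (2 * (2 + J + 2 * K)))) with hC
  have hlen : Real.log 2 * (∑ x : Fin n → Fin J, prodProb p x * ((f (φ x)).length : ℝ)) ≤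
      ∑ x : Fin n → Fin J, prodProb p x * (- Real.log (∑ y ∈ S x, M y)) + C := by
    calc _ = ∑ x : Fin n → Fin J, prodProb p x * (Real.log 2 * ((f (φ x)).length : ℝ)) := by
          rw [Finset.mul_sum]
          exact Finset.sum_congr rfl fun x _ => by ring
      _ ≤ ∑ x : Fin n → Fin J, prodProb p x * (- Real.log (∑ y ∈ S x, M y) + C) := by
          apply Finset.sum_le_sum
          intro x _
          obtain ⟨N, hN, hN2, hN3⟩ := h4 x
          exact mul_le_mul_of_nonneg_left
            (length_bound n J K N _ hn hJ hK _ (hSp x) (hA x) hN hN2 hN3) (hpx x)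
      _ = _ := by
          simp_rw [mul_add, Finset.sum_add_distrib, ← Finset.sum_mul, hp1, one_mul]
  -- choose a near-optimal test channel
  have hne : { r | ∃ Q, IsCondProb Q ∧ avgDist p Q ρ ≤ d ∧ r = mutualInfo p Q }.Nonempty := by
    refine ⟨_, Q0, hQ0, ?_, rfl⟩
    unfold avgDist
    simp_rw [mul_assoc, hz]
    simpa using hd.le
  apply le_of_forall_pos_le_add
  intro ε hε
  obtain ⟨r, ⟨Q, hQ, hQd, rfl⟩, hr⟩ := Real.lt_sInf_add_pos hne (ε := ε / n) (by positivity)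
  change mutualInfo p Q < RD p d ρ + ε / n at hr
  set Q' : Fin J → Fin K → ℝ := fun j k => (1 - l) * Q j k + l * Q0 j k with hQ'
  have hQ'c : IsCondProb Q' := by
    intro j
    refine ⟨fun k => add_nonneg (mul_nonneg (by linarith) ((hQ j).1 k))
      (mul_nonneg hl.le ((hQ0 j).1 k)), ?_⟩
    simp only [hQ', Finset.sum_add_distrib, ← Finset.mul_sum, (hQ j).2, (hQ0 j).2]
    ring
  set q : Fin K → ℝ := fun k => (1 - l) * (∑ j', p j' * Q j' k) + l * (1 / K) with hq
  have hq0 : ∀ k, 0 ≤ ∑ j', p j' * Q j' k := fun k =>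
    Finset.sum_nonneg fun j' _ => mul_nonneg (hp.1 j') ((hQ j').1 k)
  have hqpos : ∀ k, 0 < q k := fun k =>
    add_pos_of_nonneg_of_pos (mul_nonneg (by linarith) (hq0 k)) (by positivity)
  have hqprob : IsProb q := by
    refine ⟨fun k => (hqpos k).le, ?_⟩
    simp only [hq, Finset.sum_add_distrib, ← Finset.mul_sum]
    rw [Finset.sum_comm, hunif.2]
    simp_rw [← Finset.mul_sum, (hQ _).2, mul_one, hp.2]
    ring
  have hD : avgDist p Q' ρ ≤ (1 - l) * d := by
    have : avgDist p Q' ρ = (1 - l) * avgDist p Q ρ := by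
      unfold avgDist
      simp_rw [Finset.mul_sum]
      refine Finset.sum_congr rfl fun j _ => Finset.sum_congr rfl fun k _ => ?_
      have := hz j k
      simp only [hQ']
      linear_combination p j * l * this
    rw [this]
    exact mul_le_mul_of_nonneg_left hQd (by linarith)
  have htail := tail_bound n hn p Q' ρ hp hQ'c ρmax hρ s d ((1 - l) * d) hs hs1 hD
  have hexp : Real.exp (n * (s * ((1 - l) * d - d) + s ^ 2 * ρmax ^ 2)) = 1 / n := by
    have : n * (s * ((1 - l) * d - d) + s ^ 2 * ρmax ^ 2) = - Real.log n := by
      linear_combination (-(n:ℝ) * s) * hls - hs2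
    rw [this, Real.exp_neg, Real.exp_log hnr, one_div]
  rw [hexp] at htail
  have hfin := exp_bound J n K p Q' hp hQ'c q hqpos M hM hM1 (hMq q hqprob) ρ d S hS hSp
    (n * Real.log K + K * Real.log (n + 1)) hA (by positivity) (1 / n) htail
  have hmix := mix_info K hK p Q Q0 hp hQ hQ0 l hl hl1
  have hmix2 : ∑ j, ∑ k, p j * Q' j k * Real.log (Q' j k / q k) ≤
      RD p d ρ + ε / n + l * Real.log K := hmix.trans (by linarith)
  have hmix3 := mul_le_mul_of_nonneg_left hmix2 hnr.le
  have he : (n : ℝ) * (ε / n) = ε := by field_simp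
  nlinarith

set_option maxHeartbeats 2000000 in
/-- Corollary 3: fix `d > 0` and `ρ ∈ D`. The minimax redundancy
over deterministic *prefix* `d`-semifaithful codes,
`inf_{codes} sup_{p ∈ P(A)} [(ln 2/n) E_p[l(f_n(φ_n(X^n)))] − R(p,d,ρ)]`,
is `O((ln n)^{3/2}/√n)` as `n → ∞`. -/
theorem minimax_prefix_redundancy_rate (J K : ℕ) (hJ : 0 < J) (hK : 0 < K)
    (ρmax : ℝ) (hρmax : 0 < ρmax) (d : ℝ) (hd : 0 < d)
    (ρ : Fin J → Fin K → ℝ) (hρ : IsDistMeasure ρmax ρ) :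
    ∃ c : ℝ, 0 < c ∧ ∃ N : ℕ, ∀ n : ℕ, N ≤ n →
      |sInf { r : ℝ |
          ∃ (φ : (Fin n → Fin J) → (Fin n → Fin K))
            (f : (Fin n → Fin K) → List Bool)
            (g : List Bool → (Fin n → Fin K)),
            (∀ x, nDist ρ x (φ x) ≤ d) ∧
            (∀ x, g (f (φ x)) = φ x) ∧
            (∀ x₁ x₂, f (φ x₁) <+: f (φ x₂) → f (φ x₁) = f (φ x₂)) ∧
            r = sSup { v : ℝ | ∃ p : Fin J → ℝ, IsProb p ∧
                  v = (Real.log 2 / n) *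
                        (∑ x : Fin n → Fin J, prodProb p x * ((f (φ x)).length : ℝ))
                      - RD p d ρ } }|
        ≤ c * (Real.log n) ^ ((3 : ℝ) / 2) / Real.sqrt n := by
  classical
  obtain ⟨hρ1, hρ2⟩ := hρ
  choose z hz using hρ2
  let Q0 : Fin J → Fin K → ℝ := fun j k => if k = z j then 1 else 0
  have hQ0 : IsCondProb Q0 := by
    intro j
    refine ⟨fun k => ?_, by simp [Q0]⟩
    simp only [Q0]
    split_ifs <;> norm_num
  have hQz : ∀ j k, Q0 j k * ρ j k = 0 := by
    intro j k
    simp only [Q0]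
    split_ifs with h
    · rw [h, hz]; simp
    · simp
  have hKr : (1 : ℝ) ≤ K := by exact_mod_cast hK
  have hJr : (1 : ℝ) ≤ J := by exact_mod_cast hJ
  have hlogK : 0 ≤ Real.log K := Real.log_nonneg hKr
  set C0 : ℝ := 5 * Real.log 2 + Real.log J + 2 * Real.log (2 * (2 + J + 2 * K)) with hC0
  have hl2 : 0 < Real.log 2 := Real.log_pos (by norm_num)
  have hC0n : 0 ≤ C0 := by
    have h1 : 0 ≤ Real.log J := Real.log_nonneg hJr
    have h2 : 0 ≤ Real.log (2 * (2 + J + 2 * K) : ℝ) := Real.log_nonneg (by linarith)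
    linarith
  set c1 : ℝ := (1 + ρmax ^ 2) / d * Real.log K with hc1
  set c2 : ℝ := 2 * K + 3 + (Real.log 2 + Real.log K + K + C0) with hc2
  have hc1n : 0 ≤ c1 := by positivity
  have hc2p : 0 < c2 := by positivity
  have htend : Tendsto (fun n : ℕ => Real.sqrt (Real.log n / n)) atTop (nhds 0) := by
    have h1 : Tendsto (fun x : ℝ => Real.log x / x) atTop (nhds 0) :=
      Real.isLittleO_log_id_atTop.tendsto_div_nhds_zero
    have h2 := (h1.comp tendsto_natCast_atTop_atTop).sqrt
    simpa using h2
  have hev1 : ∀ᶠ n : ℕ in atTop, Real.sqrt (Real.log n / n) < 1 / ρmax :=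
    htend.eventually_lt_const (by positivity)
  have hev2 : ∀ᶠ n : ℕ in atTop, Real.sqrt (Real.log n / n) < d / (1 + ρmax ^ 2) :=
    htend.eventually_lt_const (by positivity)
  obtain ⟨N, hN⟩ := eventually_atTop.1 (hev1.and (hev2.and (eventually_ge_atTop 3)))
  refine ⟨c1 + c2, by positivity, N, fun n hNn => ?_⟩
  obtain ⟨hs1, hs2, hn3⟩ := hN n hNn
  have hn : 0 < n := by omega
  have hnr3 : (3 : ℝ) ≤ n := by exact_mod_cast hn3
  have hnr : (0 : ℝ) < n := by linarith
  have hL1 : 1 ≤ Real.log n := by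
    rw [Real.le_log_iff_exp_le hnr]
    linarith [Real.exp_one_lt_d9]
  set L := Real.log n with hL
  set s := Real.sqrt (L / n) with hs
  have hspos : 0 < s := Real.sqrt_pos.2 (by positivity)
  rw [lt_div_iff₀ hρmax] at hs1
  rw [lt_div_iff₀ (by positivity)] at hs2
  have hsq : s ^ 2 * n = L := by
    rw [hs, Real.sq_sqrt (by positivity)]; field_simp
  obtain ⟨φ, f, g, hφ, hg, hpre, hred⟩ := redundancy J K n hJ hK hn ρmax d hd ρ hρ1 Q0 hQ0 hQz
    s hspos.le hs1.le hsq ((1 + ρmax ^ 2) / d * s) (by positivity)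
    (by rw [div_mul_eq_mul_div, div_lt_one hd]; linarith) (by field_simp)
  have hnonneg : ∀ (φ : (Fin n → Fin J) → (Fin n → Fin K)) (f : (Fin n → Fin K) → List Bool),
      0 ≤ sSup { v : ℝ | ∃ p : Fin J → ℝ, IsProb p ∧
                  v = (Real.log 2 / n) *
                        (∑ x : Fin n → Fin J, prodProb p x * ((f (φ x)).length : ℝ))
                      - RD p d ρ } := fun φ f =>
    sup_nonneg J K n hJ ρ d hd.le Q0 hQ0 hQz (fun x => (f (φ x)).length)
  rw [abs_of_nonneg (Real.sInf_nonneg (by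
    rintro r ⟨φ, f, g, -, -, -, rfl⟩
    exact hnonneg φ f))]
  refine csInf_le_of_le ⟨0, ?_⟩ ⟨φ, f, g, hφ, hg, hpre, rfl⟩ ?_
  · rintro r ⟨φ, f, g, -, -, -, rfl⟩
    exact hnonneg φ f
  apply csSup_le
  · refine ⟨_, fun j : Fin J => if j = ⟨0, hJ⟩ then (1:ℝ) else 0, ⟨fun a => ?_, by simp⟩, rfl⟩
    dsimp only
    split_ifs <;> norm_num
  rintro v ⟨p, hp, rfl⟩
  have hr := hred p hp
  set E := ∑ x : Fin n → Fin J, prodProb p x * ((f (φ x)).length : ℝ) with hE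
  have hlog1 : Real.log ((n : ℝ) + 1) ≤ 2 * L := by
    have h1 : (n : ℝ) + 1 ≤ (n : ℝ) ^ 2 := by nlinarith
    have h2 := Real.log_le_log (by positivity) h1
    rw [Real.log_pow] at h2
    exact_mod_cast h2
  have hlog2 : Real.log ((n : ℝ) + 1) ≤ n := by
    have := Real.log_le_sub_one_of_pos (show (0:ℝ) < n + 1 by linarith)
    linarith
  have h5 : 1 / (n : ℝ) * (n * Real.log K + K * Real.log (n + 1)) ≤ Real.log K + K := by
    rw [one_div, inv_mul_le_iff₀ hnr]
    nlinarith
  have h6 : Real.log 2 * E ≤ n * RD p d ρ + n * (c1 * s) + c2 * L := by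
    have h7 : (K : ℝ) * Real.log (n + 1) ≤ K * (2 * L) :=
      mul_le_mul_of_nonneg_left hlog1 (by linarith)
    have h8 : Real.log 2 + Real.log K + K + C0 ≤ (Real.log 2 + Real.log K + K + C0) * L :=
      le_mul_of_one_le_right (by positivity) hL1
    have h9 : (n : ℝ) * ((1 + ρmax ^ 2) / d * s) * Real.log K = n * (c1 * s) := by
      rw [hc1]; ring
    have h10 : c2 * L = K * (2 * L) + 3 * L + (Real.log 2 + Real.log K + K + C0) * L := by
      rw [hc2]; ring
    linarith
  have h7 : Real.log 2 / n * E - RD p d ρ ≤ c1 * s + c2 * (L / n) := by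
    have h8 : Real.log 2 / n * E = (Real.log 2 * E) / n := by ring
    have h9 : (Real.log 2 * E) / n ≤ (n * RD p d ρ + n * (c1 * s) + c2 * L) / n :=
      div_le_div_of_nonneg_right h6 hnr.le
    have h10 : (n * RD p d ρ + n * (c1 * s) + c2 * L) / n = RD p d ρ + c1 * s + c2 * (L / n) := by
      field_simp
    linarith
  have hsL : 1 ≤ Real.sqrt L := Real.one_le_sqrt.2 hL1
  have hsn : 1 ≤ Real.sqrt n := Real.one_le_sqrt.2 (by linarith)
  have hpow : L ^ ((3 : ℝ) / 2) = L * Real.sqrt L := by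
    rw [show (3 : ℝ) / 2 = 1 + 1 / 2 by norm_num, Real.rpow_add (by linarith), Real.rpow_one,
      Real.sqrt_eq_rpow]
  have hb1 : s ≤ L ^ ((3 : ℝ) / 2) / Real.sqrt n := by
    rw [hs, Real.sqrt_div (by linarith), hpow]
    apply div_le_div_of_nonneg_right _ (by positivity)
    nlinarith
  have hb2 : L / n ≤ L ^ ((3 : ℝ) / 2) / Real.sqrt n := by
    rw [hpow, div_le_div_iff₀ hnr (by positivity)]
    have h8 : (n : ℝ) = Real.sqrt n * Real.sqrt n := (Real.mul_self_sqrt hnr.le).symm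
    have h9 : Real.sqrt n ≤ n := by nlinarith
    have h10 : L * Real.sqrt n ≤ L * n := mul_le_mul_of_nonneg_left h9 (by linarith)
    have h11 : L * n ≤ L * Real.sqrt L * n :=
      mul_le_mul_of_nonneg_right (le_mul_of_one_le_right (by linarith) hsL) hnr.le
    linarith
  calc _ ≤ c1 * s + c2 * (L / n) := h7
    _ ≤ c1 * (L ^ ((3 : ℝ) / 2) / Real.sqrt n) + c2 * (L ^ ((3 : ℝ) / 2) / Real.sqrt n) :=
        add_le_add (mul_le_mul_of_nonneg_left hb1 hc1n) (mul_le_mul_of_nonneg_left hb2 hc2p.le)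
    _ = _ := by ring
end
end

section
/- Fix d > 0 and a distortion measure ρ ∈ D. Then the minimax redundancy over deterministic (not necessarily prefix) d-semifaithful codes satisfies inf_{(φ_n,f_n,g_n) d-semifaithful} sup_{p ∈ P(A)} [ (ln 2 / n)·E_p[ l(f_n(φ_n(X^n))) ] − R(p,d,ρ) ] = O( (ln n)^{3/2} / √n ) as n → ∞. -/
open Filter MeasureTheory
open scoped BigOperators

noncomputable section

variable {A B : Type*}

lemma mar_sum_cons {B : Type*} [Fintype B] {n : ℕ} (F : (Fin (n+1) → B) → ℝ) :
    ∑ y, F y = ∑ b, ∑ y : Fin n → B, F (Fin.cons b y) := by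
  rw [← (Fin.consEquiv (fun _ : Fin (n+1) => B)).sum_comp, Fintype.sum_prod_type]
  rfl

lemma mar_sum_one {B : Type*} [Fintype B] {n : ℕ} (V : Fin n → B → ℝ)
    (hV : ∀ i, ∑ b, V i b = 1) : ∑ y : Fin n → B, ∏ i, V i (y i) = 1 := by
  induction n with
  | zero => simp
  | succ n ih =>
    rw [mar_sum_cons]
    simp only [Fin.prod_univ_succ, Fin.cons_zero, Fin.cons_succ, ← Finset.mul_sum]
    rw [ih (fun i => V i.succ) (fun i => hV _)]
    simp [hV]

lemma mar_sum_lin {B : Type*} [Fintype B] {n : ℕ} (V g : Fin n → B → ℝ)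
    (hV : ∀ i, ∑ b, V i b = 1) :
    ∑ y : Fin n → B, (∏ i, V i (y i)) * ∑ i, g i (y i) = ∑ i, ∑ b, V i b * g i b := by
  induction n with
  | zero => simp
  | succ n ih =>
    rw [mar_sum_cons]
    simp only [Fin.prod_univ_succ, Fin.sum_univ_succ, Fin.cons_zero, Fin.cons_succ]
    have h1 := mar_sum_one (fun i => V i.succ) (fun i => hV _)
    have h2 := ih (fun i => V i.succ) (fun i => g i.succ) (fun i => hV _)
    have : ∀ b, ∑ y : Fin n → B, V 0 b * (∏ i, V i.succ (y i)) *
        (g 0 b + ∑ i, g i.succ (y i)) =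
        V 0 b * g 0 b + V 0 b * ∑ i : Fin n, ∑ b, V i.succ b * g i.succ b := by
      intro b
      rw [← h2]
      calc _ = ∑ y : Fin n → B, ((V 0 b * g 0 b) * (∏ i, V i.succ (y i)) +
            V 0 b * ((∏ i, V i.succ (y i)) * ∑ i, g i.succ (y i))) :=
            Finset.sum_congr rfl (fun y _ => by ring)
        _ = _ := by
            rw [Finset.sum_add_distrib, ← Finset.mul_sum, ← Finset.mul_sum, h1, mul_one]
    simp only [this]
    rw [Finset.sum_add_distrib, ← Finset.sum_mul, hV, one_mul]

lemma mar_sum_sq {B : Type*} [Fintype B] {n : ℕ} (V g : Fin n → B → ℝ)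
    (hV : ∀ i, ∑ b, V i b = 1) (hg : ∀ i, ∑ b, V i b * g i b = 0) :
    ∑ y : Fin n → B, (∏ i, V i (y i)) * (∑ i, g i (y i)) ^ 2 =
      ∑ i, ∑ b, V i b * g i b ^ 2 := by
  induction n with
  | zero => simp
  | succ n ih =>
    rw [mar_sum_cons]
    simp only [Fin.prod_univ_succ, Fin.sum_univ_succ, Fin.cons_zero, Fin.cons_succ]
    have h1 := mar_sum_one (fun i => V i.succ) (fun i => hV _)
    have h2 := mar_sum_lin (fun i => V i.succ) (fun i => g i.succ) (fun i => hV _)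
    have h3 := ih (fun i => V i.succ) (fun i => g i.succ) (fun i => hV _) (fun i => hg _)
    simp only [hg, Finset.sum_const_zero] at h2
    have : ∀ b, ∑ y : Fin n → B, V 0 b * (∏ i, V i.succ (y i)) *
        (g 0 b + ∑ i, g i.succ (y i)) ^ 2 =
        V 0 b * g 0 b ^ 2 + V 0 b * ∑ i : Fin n, ∑ b, V i.succ b * g i.succ b ^ 2 := by
      intro b
      rw [← h3]
      calc _ = ∑ y : Fin n → B, ((V 0 b * g 0 b ^ 2) * (∏ i, V i.succ (y i)) +
            (2 * V 0 b * g 0 b) * ((∏ i, V i.succ (y i)) * ∑ i, g i.succ (y i)) +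
            V 0 b * ((∏ i, V i.succ (y i)) * (∑ i, g i.succ (y i)) ^ 2)) :=
            Finset.sum_congr rfl (fun y _ => by ring)
        _ = _ := by
            rw [Finset.sum_add_distrib, Finset.sum_add_distrib, ← Finset.mul_sum,
              ← Finset.mul_sum, ← Finset.mul_sum, h1, h2]
            ring
    simp only [this]
    rw [Finset.sum_add_distrib, ← Finset.sum_mul, hV, one_mul]

/-- variance bound without centering -/
lemma mar_var {B : Type*} [Fintype B] {n : ℕ} (V g : Fin n → B → ℝ)
    (hV : ∀ i, ∑ b, V i b = 1) (v : ℝ)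
    (hv : ∀ i, ∑ b, V i b * g i b ^ 2 ≤ v) :
    ∑ y : Fin n → B, (∏ i, V i (y i)) *
      (∑ i, g i (y i) - ∑ i, ∑ b, V i b * g i b) ^ 2 ≤ n * v := by
  set m : Fin n → ℝ := fun i => ∑ b, V i b * g i b with hm
  have h := mar_sum_sq V (fun i b => g i b - m i) hV (by
    intro i
    simp only [mul_sub, Finset.sum_sub_distrib, ← Finset.sum_mul, hV, one_mul]
    simp [hm])
  simp only [Finset.sum_sub_distrib] at h
  rw [h]
  calc _ ≤ ∑ i : Fin n, v := by
        refine Finset.sum_le_sum (fun i _ => ?_)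
        refine le_trans ?_ (hv i)
        have : ∑ b, V i b * (g i b - m i) ^ 2 = ∑ b, V i b * g i b ^ 2 - m i ^ 2 := by
          calc _ = ∑ b, (V i b * g i b ^ 2 - (2 * m i) * (V i b * g i b) + m i ^ 2 * V i b) :=
                Finset.sum_congr rfl (fun y _ => by ring)
            _ = _ := by
                rw [Finset.sum_add_distrib, Finset.sum_sub_distrib, ← Finset.mul_sum,
                  ← Finset.mul_sum, hV]
                change _ - 2 * m i * m i + _ = _
                ring
        rw [this]
        nlinarith [sq_nonneg (m i)]
    _ = n * v := by simp

lemma mar_cheb {B : Type*} [Fintype B] {n : ℕ} (V g : Fin n → B → ℝ)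
    (hV0 : ∀ i b, 0 ≤ V i b)
    (hV : ∀ i, ∑ b, V i b = 1) (v : ℝ)
    (hv : ∀ i, ∑ b, V i b * g i b ^ 2 ≤ v) (t : ℝ) (ht : 0 < t) (hvt : 4 * (n * v) ≤ t ^ 2)
    (S : Finset (Fin n → B))
    (hS : ∀ y ∈ S, ∑ i, ∑ b, V i b * g i b + t ≤ ∑ i, g i (y i)) :
    ∑ y ∈ S, (∏ i, V i (y i)) ≤ 1 / 4 := by
  have h := mar_var V g hV v hv
  have hp : ∀ y : Fin n → B, 0 ≤ ∏ i, V i (y i) :=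
    fun y => Finset.prod_nonneg (fun i _ => hV0 _ _)
  have h2 : ∑ y ∈ S, (∏ i, V i (y i)) * t ^ 2 ≤ n * v := by
    refine le_trans ?_ h
    refine le_trans (Finset.sum_le_sum (fun y hy => ?_))
      (Finset.sum_le_sum_of_subset_of_nonneg (Finset.subset_univ S)
        (fun y _ _ => mul_nonneg (hp y) (sq_nonneg _)))
    refine mul_le_mul_of_nonneg_left ?_ (hp y)
    have := hS y hy
    exact pow_le_pow_left₀ ht.le (by linarith) 2
  rw [← Finset.sum_mul] at h2
  have : 0 < t ^ 2 := by positivity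
  by_contra hc
  push Not at hc
  nlinarith

lemma mar_abs {B : Type*} [Fintype B] {n : ℕ} (V g : Fin n → B → ℝ)
    (hV0 : ∀ i b, 0 ≤ V i b)
    (hV : ∀ i, ∑ b, V i b = 1) (v : ℝ)
    (hv : ∀ i, ∑ b, V i b * g i b ^ 2 ≤ v) (c : ℝ) (hc : 0 < c) (hcv : n * v ≤ c ^ 2) :
    ∑ y : Fin n → B, (∏ i, V i (y i)) *
      |∑ i, g i (y i) - ∑ i, ∑ b, V i b * g i b| ≤ c := by
  have h := mar_var V g hV v hv
  have hp : ∀ y : Fin n → B, 0 ≤ ∏ i, V i (y i) :=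
    fun y => Finset.prod_nonneg (fun i _ => hV0 _ _)
  set s : (Fin n → B) → ℝ := fun y => ∑ i, g i (y i) - ∑ i, ∑ b, V i b * g i b with hs
  have h1 := mar_sum_one V hV
  have : ∑ y : Fin n → B, (∏ i, V i (y i)) * (2 * c * |s y|) ≤
      ∑ y : Fin n → B, ((∏ i, V i (y i)) * s y ^ 2 + c ^ 2 * (∏ i, V i (y i))) := by
    refine Finset.sum_le_sum (fun y _ => ?_)
    have := mul_nonneg (hp y) (sq_nonneg (|s y| - c))
    have h3 := sq_abs (s y)
    rw [← h3]
    nlinarith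
  rw [Finset.sum_add_distrib, ← Finset.mul_sum, h1] at this
  have h4 : ∑ y : Fin n → B, (∏ i, V i (y i)) * (2 * c * |s y|) =
      2 * c * ∑ y : Fin n → B, (∏ i, V i (y i)) * |s y| := by
    rw [Finset.mul_sum]; exact Finset.sum_congr rfl (fun y _ => by ring)
  rw [h4] at this
  have h5 : 2 * c * ∑ y : Fin n → B, (∏ i, V i (y i)) * |s y| ≤ 2 * c * c := by
    nlinarith
  exact le_of_mul_le_mul_left h5 (by positivity)

open Classical in
lemma mar_pick {X Y : Type*} [Fintype Y] (cov : X → Y → Prop) (W : Y → ℝ)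
    (hW0 : ∀ y, 0 ≤ W y) (hW1 : ∑ y, W y = 1) (U : Finset X) (a : X → ℝ) (ha : ∀ x, 0 ≤ a x) :
    ∃ y, ∑ x ∈ U.filter (fun x => ¬ cov x y),
      a x * Real.exp (∑ y ∈ Finset.univ.filter (cov x), W y) ≤ ∑ x ∈ U, a x := by
  by_contra hc
  push Not at hc
  set w : X → ℝ := fun x => ∑ y ∈ Finset.univ.filter (cov x), W y with hw
  have hlt : ∑ y, W y * ∑ x ∈ U, a x < ∑ y, W y * ∑ x ∈ U.filter (fun x => ¬ cov x y),
      a x * Real.exp (w x) := by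
    refine Finset.sum_lt_sum (fun y _ => mul_le_mul_of_nonneg_left (hc y).le (hW0 y)) ?_
    by_contra h0
    push Not at h0
    have : ∑ y, W y ≤ 0 := by
      refine Finset.sum_nonpos (fun y hy => ?_)
      by_contra h1
      push Not at h1
      exact absurd (h0 y hy) (not_le.mpr (mul_lt_mul_of_pos_left (hc y) h1))
    linarith
  rw [← Finset.sum_mul, hW1, one_mul] at hlt
  have : ∑ y, W y * ∑ x ∈ U.filter (fun x => ¬ cov x y), a x * Real.exp (w x) =
      ∑ x ∈ U, (1 - w x) * Real.exp (w x) * a x := by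
    simp only [Finset.sum_filter, Finset.mul_sum]
    rw [Finset.sum_comm]
    refine Finset.sum_congr rfl (fun x _ => ?_)
    have : 1 - w x = ∑ y, if cov x y then 0 else W y := by
      rw [← hW1, hw]
      simp only [Finset.sum_filter]
      rw [← Finset.sum_sub_distrib]
      refine Finset.sum_congr rfl (fun y _ => ?_)
      split_ifs <;> simp
    rw [this, mul_assoc, Finset.sum_mul]
    refine Finset.sum_congr rfl (fun y _ => ?_)
    split_ifs
    · simp_all
    · ring
  rw [this] at hlt
  refine absurd hlt (not_lt.mpr (Finset.sum_le_sum (fun x _ => ?_)))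
  have h1 : (1 - w x) * Real.exp (w x) ≤ 1 := by
    have h := Real.one_sub_le_exp_neg (w x)
    calc _ ≤ Real.exp (-w x) * Real.exp (w x) :=
          mul_le_mul_of_nonneg_right h (Real.exp_pos _).le
      _ = 1 := by rw [← Real.exp_add]; simp
  calc _ ≤ 1 * a x := mul_le_mul_of_nonneg_right h1 (ha x)
    _ = a x := one_mul _

open Classical in
lemma mar_greedy {X Y : Type*} [Fintype X] [Fintype Y] (cov : X → Y → Prop) (W : Y → ℝ)
    (hW0 : ∀ y, 0 ≤ W y) (hW1 : ∑ y, W y = 1) :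
    ∃ c : ℕ → Y, ∀ x, ∀ i : ℕ, (∀ k < i, ¬ cov x (c k)) →
      Real.exp (i * ∑ y ∈ Finset.univ.filter (cov x), W y) ≤ Fintype.card X := by
  set w : X → ℝ := fun x => ∑ y ∈ Finset.univ.filter (cov x), W y with hw
  have hp : ∀ (i : ℕ) (U : Finset X), ∃ y, ∑ x ∈ U.filter (fun x => ¬ cov x y),
      Real.exp (i * w x) * Real.exp (w x) ≤ ∑ x ∈ U, Real.exp (i * w x) := fun i U =>
    mar_pick cov W hW0 hW1 U (fun x => Real.exp (i * w x)) (fun x => (Real.exp_pos _).le)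
  choose pick hpick using hp
  let U : ℕ → Finset X := fun i => Nat.rec Finset.univ
    (fun i V => V.filter (fun x => ¬ cov x (pick i V))) i
  have hU : ∀ i, U (i+1) = (U i).filter (fun x => ¬ cov x (pick i (U i))) := fun i => rfl
  have hinv : ∀ i : ℕ, ∑ x ∈ U i, Real.exp (i * w x) ≤ Fintype.card X := by
    intro i
    induction i with
    | zero => simp [U]
    | succ i ih =>
      refine le_trans ?_ (le_trans (hpick i (U i)) ih)
      rw [hU]
      refine le_of_eq (Finset.sum_congr rfl (fun x _ => ?_))
      rw [← Real.exp_add]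
      push_cast
      ring_nf
  refine ⟨fun i => pick i (U i), fun x i hi => ?_⟩
  have hmem : ∀ m, m ≤ i → x ∈ U m := by
    intro m
    induction m with
    | zero => intro _; simp [U]
    | succ m ih =>
      intro hm
      rw [hU, Finset.mem_filter]
      exact ⟨ih (by omega), hi m (by omega)⟩
  exact le_trans (Finset.single_le_sum (f := fun x => Real.exp (i * w x))
    (fun x _ => (Real.exp_pos _).le) (hmem i le_rfl)) (hinv i)

open Classical in
lemma mar_code {X Y : Type*} [Fintype X] [Fintype Y] [Nonempty X]
    (cov : X → Y → Prop) (W : Y → ℝ)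
    (hW0 : ∀ y, 0 ≤ W y) (hW1 : ∑ y, W y = 1)
    (hpos : ∀ x, 0 < ∑ y ∈ Finset.univ.filter (cov x), W y) (M : ℝ) (hM1 : 1 ≤ M)
    (hM : Real.log (Fintype.card X) ≤ M) :
    ∃ (φ : X → Y) (f : Y → List Bool) (g : List Bool → Y),
      (∀ x, cov x (φ x)) ∧ (∀ x, g (f (φ x)) = φ x) ∧
      ∀ x, Real.log 2 * (f (φ x)).length ≤
        Real.log (3 * M) - Real.log (∑ y ∈ Finset.univ.filter (cov x), W y) := by
  obtain ⟨c, hc⟩ := mar_greedy cov W hW0 hW1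
  set w : X → ℝ := fun x => ∑ y ∈ Finset.univ.filter (cov x), W y with hw
  have hN : ∀ x, ∃ k : ℕ, cov x (c k) ∧ (k : ℝ) ≤ M / w x := by
    intro x
    by_contra h
    push Not at h
    have h1 := hc x (⌊M / w x⌋₊ + 1) (by
      intro k hk hcov
      have h2 := h k hcov
      have h3 : ((⌊M / w x⌋₊ : ℕ) : ℝ) ≤ M / w x :=
        Nat.floor_le (div_nonneg (by linarith) (hpos x).le)
      have h4 : (k : ℝ) ≤ ⌊M / w x⌋₊ := by exact_mod_cast (by omega)
      linarith)
    have h5 := Real.log_le_log (Real.exp_pos _) h1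
    rw [Real.log_exp] at h5
    push_cast at h5
    have h6 := Nat.lt_floor_add_one (M / w x)
    rw [div_lt_iff₀ (hpos x)] at h6
    change _ * w x ≤ _ at h5
    linarith
  choose N hNc hNle using hN
  let idx : Y → ℕ := fun z => if h : ∃ i, c i = z then Nat.find h else 0
  have hidx1 : ∀ i, c (idx (c i)) = c i := by
    intro i
    have h : ∃ k, c k = c i := ⟨i, rfl⟩
    simp only [idx, dif_pos h]
    exact Nat.find_spec h
  have hidx2 : ∀ i, idx (c i) ≤ i := by
    intro i
    have h : ∃ k, c k = c i := ⟨i, rfl⟩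
    simp only [idx, dif_pos h]
    exact Nat.find_min' h rfl
  have hinj : Function.Injective Nat.bits := by
    have hdec : ∀ a : ℕ, (Nat.bits a).foldr Nat.bit 0 = a := by
      intro a
      induction a using Nat.binaryRec' with
      | zero => simp
      | bit b m h ih => rw [Nat.bits_append_bit _ _ h, List.foldr_cons, ih]
    intro a b hab
    rw [← hdec a, ← hdec b, hab]
  refine ⟨fun x => c (N x), fun z => Nat.bits (idx z), fun l => c (Function.invFun Nat.bits l),
    hNc, ?_, ?_⟩
  · intro x
    simp only [Function.leftInverse_invFun hinj _]
    exact hidx1 _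
  · intro x
    rw [Nat.size_eq_bits_len]
    set m := idx (c (N x)) with hm
    have h1 : 2 ^ Nat.size m ≤ 2 * m + 1 := by
      rcases hs : Nat.size m with _ | s
      · simp
      · have : s < Nat.size m := by omega
        rw [Nat.lt_size] at this
        rw [pow_succ]; omega
    have hw1 : w x ≤ 1 := by
      rw [← hW1]
      exact Finset.sum_le_sum_of_subset_of_nonneg (Finset.filter_subset _ _) (fun y _ _ => hW0 y)
    have h2 : (2 : ℝ) ^ Nat.size m ≤ 3 * M / w x := by
      have h3 : ((2 ^ Nat.size m : ℕ) : ℝ) ≤ ((2 * m + 1 : ℕ) : ℝ) := by exact_mod_cast h1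
      push_cast at h3
      have h4 : (m : ℝ) ≤ M / w x := le_trans (by exact_mod_cast hidx2 (N x)) (hNle x)
      have h5 : 1 ≤ M / w x := by
        rw [le_div_iff₀ (hpos x)]; linarith
      have : 3 * M / w x = 3 * (M / w x) := by ring
      rw [this]; linarith
    have h6 := Real.log_le_log (by positivity) h2
    rw [Real.log_pow, Real.log_div (by positivity) (hpos x).ne'] at h6
    linarith

lemma mar_univ (n K : ℕ) (hn : 0 < n) (hK : 0 < K) :
    ∃ W : (Fin n → Fin K) → ℝ, (∀ y, 0 < W y) ∧ ∑ y, W y = 1 ∧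
      ∀ q : Fin K → ℝ, IsProb q → ∀ y,
        Real.exp (-K) / ((n : ℝ) + 1) ^ K * ∏ i, q (y i) ≤ W y := by
  have : Nonempty (Fin K) := ⟨⟨0, hK⟩⟩
  have hn' : (0 : ℝ) < n := by exact_mod_cast hn
  have hK' : (0 : ℝ) < K := by exact_mod_cast hK
  let qc : (Fin K → Fin (n+1)) → Fin K → ℝ := fun c k =>
    (((c k : ℕ) : ℝ) + 1) / ∑ k', (((c k' : ℕ) : ℝ) + 1)
  have hden : ∀ c : Fin K → Fin (n+1), 0 < ∑ k', (((c k' : ℕ) : ℝ) + 1) := fun c =>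
    Finset.sum_pos (fun k _ => by positivity) Finset.univ_nonempty
  have hqc0 : ∀ c k, 0 < qc c k := fun c k => div_pos (by positivity) (hden c)
  have hqc1 : ∀ c, ∑ k, qc c k = 1 := by
    intro c
    simp only [qc]
    rw [← Finset.sum_div, div_self (hden c).ne']
  refine ⟨fun y => (∑ c, ∏ i, qc c (y i)) / ((n : ℝ) + 1) ^ K, ?_, ?_, ?_⟩
  · intro y
    refine div_pos (Finset.sum_pos (fun c _ => Finset.prod_pos (fun i _ => hqc0 _ _))
      Finset.univ_nonempty) (by positivity)
  · rw [← Finset.sum_div, Finset.sum_comm]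
    have : ∀ c, ∑ y : Fin n → Fin K, ∏ i, qc c (y i) = 1 :=
      fun c => mar_sum_one (fun _ => qc c) (fun _ => hqc1 c)
    simp only [this]
    have h2 : ((n : ℝ) + 1) ^ K ≠ 0 := by positivity
    simp only [Finset.sum_const, Finset.card_univ, Fintype.card_fun, Fintype.card_fin,
      nsmul_eq_mul, mul_one]
    push_cast
    exact div_self h2
  · intro q hq y
    rw [div_mul_eq_mul_div]
    refine div_le_div_of_nonneg_right ?_ (by positivity)
    have hq1 : ∀ k, q k ≤ 1 := fun k => by
      rw [← hq.2]
      exact Finset.single_le_sum (f := q) (fun k _ => hq.1 k) (Finset.mem_univ k)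
    have hfl : ∀ k, ⌊n * q k⌋₊ < n + 1 := fun k => by
      have : ⌊n * q k⌋₊ ≤ n := by
        refine Nat.floor_le_of_le ?_
        nlinarith [hq1 k]
      omega
    let c : Fin K → Fin (n+1) := fun k => ⟨⌊n * q k⌋₊, hfl k⟩
    have hc1 : ∀ k, n * q k ≤ ((c k : ℕ) : ℝ) + 1 := fun k => (Nat.lt_floor_add_one _).le
    have hc2 : ∑ k, (((c k : ℕ) : ℝ) + 1) ≤ n + K := by
      calc _ ≤ ∑ k, (n * q k + 1) := Finset.sum_le_sum (fun k _ => by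
              have : ((⌊n * q k⌋₊ : ℕ) : ℝ) ≤ n * q k :=
                Nat.floor_le (mul_nonneg hn'.le (hq.1 k))
              simpa [c] using this)
        _ = n + K := by
            rw [Finset.sum_add_distrib, ← Finset.mul_sum, hq.2]; simp
    have hkey : ∀ k, Real.exp (-(K / n)) * q k ≤ qc c k := by
      intro k
      have h1 : n * q k / (n + K) ≤ qc c k := by
        simp only [qc]
        exact div_le_div₀ (by positivity) (hc1 k) (hden c) hc2
      refine le_trans ?_ h1
      have h2 : Real.exp (-((K : ℝ) / n)) ≤ n / (n + K) := by
        rw [Real.exp_neg, inv_le_comm₀ (Real.exp_pos _) (by positivity)]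
        have := Real.add_one_le_exp ((K : ℝ) / n)
        refine le_trans (le_of_eq ?_) this
        field_simp
        ring
      calc _ ≤ n / (n + K) * q k := mul_le_mul_of_nonneg_right h2 (hq.1 k)
        _ = _ := by ring
    refine le_trans ?_ (Finset.single_le_sum (f := fun c => ∏ i, qc c (y i))
      (fun c _ => Finset.prod_nonneg (fun i _ => (hqc0 _ _).le)) (Finset.mem_univ c))
    calc Real.exp (-K) * ∏ i, q (y i) = ∏ i, (Real.exp (-(K / n)) * q (y i)) := by
          rw [Finset.prod_mul_distrib, Finset.prod_const, ← Real.exp_nat_mul]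
          congr 2
          simp
          field_simp
      _ ≤ _ := Finset.prod_le_prod
          (fun i _ => mul_nonneg (Real.exp_pos _).le (hq.1 _)) (fun i _ => hkey _)

lemma mar_second {K : ℕ} (P q : Fin K → ℝ) (hP : IsProb P) (L : ℝ)
    (hq0 : ∀ k, 0 < q k) (hq1 : ∀ k, q k ≤ 1) (hqL : ∀ k, -L ≤ Real.log (q k)) :
    ∑ k, P k * Real.log (P k / q k) ^ 2 ≤ 8 * K + 2 * L ^ 2 := by
  have hP1 : ∀ k, P k ≤ 1 := fun k => by
    rw [← hP.2]
    exact Finset.single_le_sum (f := P) (fun k _ => hP.1 k) (Finset.mem_univ k)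
  calc _ ≤ ∑ k, (8 + 2 * L ^ 2 * P k) := by
        refine Finset.sum_le_sum (fun k _ => ?_)
        rcases (hP.1 k).eq_or_lt with h0 | h0
        · rw [← h0]; simp
        · rw [Real.log_div h0.ne' (hq0 k).ne']
          have h1 : P k * Real.log (P k) ^ 2 ≤ 4 := by
            have hs : 0 < Real.sqrt (P k) := Real.sqrt_pos.mpr h0
            have := Real.abs_log_mul_self_lt (Real.sqrt (P k)) hs
              (by rw [← Real.sqrt_one]; exact Real.sqrt_le_sqrt (hP1 k))
            rw [Real.log_sqrt h0.le] at this
            have h2 := (sq_lt_one_iff_abs_lt_one _).mpr this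
            have h3 : (Real.log (P k) / 2 * Real.sqrt (P k)) ^ 2 =
                Real.log (P k) ^ 2 * P k / 4 := by
              rw [mul_pow, Real.sq_sqrt h0.le]; ring
            rw [h3] at h2
            linarith
          have h2 : Real.log (q k) ^ 2 ≤ L ^ 2 := by
            have := Real.log_nonpos (hq0 k).le (hq1 k)
            nlinarith [hqL k]
          have h3 : (Real.log (P k) - Real.log (q k)) ^ 2 ≤
              2 * Real.log (P k) ^ 2 + 2 * Real.log (q k) ^ 2 := by
            nlinarith [sq_nonneg (Real.log (P k) + Real.log (q k))]
          calc _ ≤ P k * (2 * Real.log (P k) ^ 2 + 2 * L ^ 2) :=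
                mul_le_mul_of_nonneg_left (by linarith) h0.le
            _ ≤ _ := by linarith
    _ = _ := by
        rw [Finset.sum_add_distrib, ← Finset.mul_sum, hP.2]; simp; ring

lemma mar_log (a c r : ℝ) (ha : 0 ≤ a) (hc : 0 ≤ c) (hac : c = 0 → a = 0) (hr : 0 < r) :
    a * Real.log r + a - c * r ≤ a * Real.log (a / c) := by
  rcases ha.eq_or_lt with h0 | h0
  · rw [← h0]; simp; positivity
  have hc0 : 0 < c := lt_of_le_of_ne hc (fun h => h0.ne' (hac h.symm))
  have h1 := Real.log_le_sub_one_of_pos (x := c * r / a) (by positivity)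
  rw [Real.log_div (by positivity) h0.ne', Real.log_mul hc0.ne' hr.ne'] at h1
  rw [Real.log_div h0.ne' hc0.ne']
  have h2 := mul_le_mul_of_nonneg_left h1 h0.le
  have h3 : a * (c * r / a - 1) = c * r - a := by field_simp
  rw [h3] at h2
  nlinarith

lemma mar_logsum (a b c e : ℝ) (ha : 0 ≤ a) (hb : 0 ≤ b) (hc : 0 ≤ c) (hac : c = 0 → a = 0)
    (he : 0 < e) :
    (a + b) * Real.log ((a + b) / (c + e)) ≤ a * Real.log (a / c) + b * Real.log (b / e) := by
  rcases (add_nonneg ha hb).eq_or_lt with h0 | h0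
  · have h1 : a = 0 := by linarith
    have h2 : b = 0 := by linarith
    simp [h1, h2]
  have hr : 0 < (a + b) / (c + e) := by positivity
  have h1 := mar_log a c _ ha hc hac hr
  have h2 := mar_log b e _ hb he.le (fun h => absurd h he.ne') hr
  have h3 : (c + e) * ((a + b) / (c + e)) = a + b := by field_simp
  nlinarith

lemma mar_div {K : ℕ} (P q : Fin K → ℝ) (hP : IsProb P) (hq : IsProb q)
    (hac : ∀ k, q k = 0 → P k = 0) : 0 ≤ ∑ k, P k * Real.log (P k / q k) := by
  calc (0 : ℝ) = ∑ k, (P k - q k) := by rw [Finset.sum_sub_distrib, hP.2, hq.2]; simp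
    _ ≤ _ := Finset.sum_le_sum (fun k _ => by
        have := mar_log (P k) (q k) 1 (hP.1 k) (hq.1 k) (hac k) one_pos
        simpa using this)

lemma mar_mix {K : ℕ} (hK : 0 < K) (P q P0 : Fin K → ℝ) (hP : IsProb P) (hq : IsProb q)
    (hP0 : IsProb P0) (hac : ∀ k, q k = 0 → P k = 0) (lam : ℝ) (h0 : 0 < lam) (h1 : lam ≤ 1) :
    ∑ k, ((1 - lam) * P k + lam * P0 k) *
      Real.log (((1 - lam) * P k + lam * P0 k) / ((1 - lam) * q k + lam / K)) ≤
    ∑ k, P k * Real.log (P k / q k) + lam * Real.log K := by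
  have hK' : (0 : ℝ) < K := by exact_mod_cast hK
  have hD := mar_div P q hP hq hac
  have hP01 : ∀ k, P0 k ≤ 1 := fun k => by
    rw [← hP0.2]
    exact Finset.single_le_sum (f := P0) (fun k _ => hP0.1 k) (Finset.mem_univ k)
  have hterm : ∀ k, ((1 - lam) * P k + lam * P0 k) *
      Real.log (((1 - lam) * P k + lam * P0 k) / ((1 - lam) * q k + lam / K)) ≤
      (1 - lam) * (P k * Real.log (P k / q k)) + lam * Real.log K * P0 k := by
    intro k
    refine le_trans (mar_logsum _ _ _ _ (mul_nonneg (by linarith) (hP.1 k))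
      (mul_nonneg h0.le (hP0.1 k)) (mul_nonneg (by linarith) (hq.1 k)) ?_ (by positivity)) ?_
    · intro h
      rcases mul_eq_zero.mp h with h | h
      · rw [h, zero_mul]
      · rw [hac k h, mul_zero]
    · refine add_le_add ?_ ?_
      · rcases h1.eq_or_lt with h | h
        · rw [h]; simp
        · rw [mul_div_mul_left _ _ (by linarith), mul_assoc]
      · rcases (hP0.1 k).eq_or_lt with h | h
        · rw [← h]; simp
        · have : lam * P0 k / (lam / K) = P0 k * K := by field_simp
          rw [this]
          have h2 : Real.log (P0 k * K) ≤ Real.log K :=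
            Real.log_le_log (by positivity) (by nlinarith [hP01 k])
          nlinarith [mul_le_mul_of_nonneg_left h2 (mul_nonneg h0.le h.le)]
  refine le_trans (Finset.sum_le_sum (fun k _ => hterm k)) ?_
  rw [Finset.sum_add_distrib, ← Finset.mul_sum, ← Finset.mul_sum, hP0.2]
  nlinarith

open Classical in
lemma mar_ball {J K n : ℕ} (hn : 0 < n) (ρmax : ℝ) (hρmax : 0 < ρmax) (d : ℝ)
    (ρ : Fin J → Fin K → ℝ) (hρ : IsDistMeasure ρmax ρ)
    (P : Fin J → Fin K → ℝ) (hP : IsCondProb P) (q : Fin K → ℝ)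
    (hq0 : ∀ k, 0 < q k) (hq1 : ∀ k, q k ≤ 1) (L : ℝ) (hqL : ∀ k, -L ≤ Real.log (q k))
    (x : Fin n → Fin J)
    (hx : ∑ i, ∑ k, P (x i) k * ρ (x i) k ≤ n * d - 2 * ρmax * Real.sqrt n)
    (t : ℝ) (ht : 0 < t) (htv : 4 * (n * (8 * K + 2 * L ^ 2)) ≤ t ^ 2) :
    1 / 2 * Real.exp (-(∑ i, ∑ k, P (x i) k * Real.log (P (x i) k / q k)) - t) ≤
      ∑ y ∈ Finset.univ.filter (fun y : Fin n → Fin K => nDist ρ x y ≤ d), ∏ i, q (y i) := by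
  have hn' : (0 : ℝ) < n := by exact_mod_cast hn
  set m := ∑ i, ∑ k, P (x i) k * Real.log (P (x i) k / q k) with hm
  let V : Fin n → Fin K → ℝ := fun i => P (x i)
  have hV0 : ∀ i b, 0 ≤ V i b := fun i b => (hP (x i)).1 b
  have hV1 : ∀ i, ∑ b, V i b = 1 := fun i => (hP (x i)).2
  set S1 := Finset.univ.filter (fun y : Fin n → Fin K => ¬ nDist ρ x y ≤ d) with hS1
  set S2 := Finset.univ.filter (fun y : Fin n → Fin K =>
    m + t ≤ ∑ i, Real.log (P (x i) (y i) / q (y i))) with hS2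
  set G := Finset.univ.filter (fun y : Fin n → Fin K => nDist ρ x y ≤ d ∧
    ¬ (m + t ≤ ∑ i, Real.log (P (x i) (y i) / q (y i)))) with hG
  have b1 : ∑ y ∈ S1, ∏ i, V i (y i) ≤ 1 / 4 := by
    refine mar_cheb V (fun i b => ρ (x i) b) hV0 hV1 (ρmax ^ 2) ?_ (2 * ρmax * Real.sqrt n)
      (by positivity) ?_ S1 ?_
    · intro i
      calc _ ≤ ∑ b, V i b * ρmax ^ 2 := Finset.sum_le_sum (fun b _ =>
            mul_le_mul_of_nonneg_left
              (pow_le_pow_left₀ (hρ.1 _ _).1 (hρ.1 _ _).2 2) (hV0 i b))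
        _ = _ := by rw [← Finset.sum_mul, hV1, one_mul]
    · rw [mul_pow, mul_pow, Real.sq_sqrt hn'.le]; linarith
    · intro y hy
      rw [hS1, Finset.mem_filter] at hy
      have h := hy.2
      push Not at h
      unfold nDist at h
      rw [lt_div_iff₀ hn'] at h
      simp only [V]
      linarith
  have b2 : ∑ y ∈ S2, ∏ i, V i (y i) ≤ 1 / 4 := by
    refine mar_cheb V (fun i b => Real.log (P (x i) b / q b)) hV0 hV1 (8 * K + 2 * L ^ 2) ?_ t
      ht htv S2 ?_
    · intro i
      exact mar_second (P (x i)) q (hP (x i)) L hq0 hq1 hqL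
    · intro y hy
      rw [hS2, Finset.mem_filter] at hy
      exact hy.2
  have hVn : ∀ y : Fin n → Fin K, 0 ≤ ∏ i, V i (y i) :=
    fun y => Finset.prod_nonneg (fun i _ => hV0 _ _)
  have b3 : 1 / 2 ≤ ∑ y ∈ G, ∏ i, V i (y i) := by
    have h1 := mar_sum_one V hV1
    have h2 : ∑ y : Fin n → Fin K, ∏ i, V i (y i) ≤ ∑ y ∈ G, ∏ i, V i (y i) +
        ∑ y ∈ S1, ∏ i, V i (y i) + ∑ y ∈ S2, ∏ i, V i (y i) := by
      rw [hG, hS1, hS2, Finset.sum_filter, Finset.sum_filter, Finset.sum_filter,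
        ← Finset.sum_add_distrib, ← Finset.sum_add_distrib]
      refine Finset.sum_le_sum (fun y _ => ?_)
      have := hVn y
      by_cases h3 : nDist ρ x y ≤ d <;>
      by_cases h4 : m + t ≤ ∑ i, Real.log (P (x i) (y i) / q (y i)) <;>
      simp [h3, h4, this]
    linarith
  have hfac : ∀ j k, P j k * Real.exp (-Real.log (P j k / q k)) ≤ q k := by
    intro j k
    rcases ((hP j).1 k).eq_or_lt with h | h
    · rw [← h]; simp [(hq0 k).le]
    · rw [Real.exp_neg, Real.exp_log (div_pos h (hq0 k))]
      apply le_of_eq; field_simp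
  calc _ ≤ (∑ y ∈ G, ∏ i, V i (y i)) * Real.exp (-m - t) :=
        mul_le_mul_of_nonneg_right b3 (Real.exp_pos _).le
    _ = ∑ y ∈ G, (∏ i, V i (y i)) * Real.exp (-m - t) := Finset.sum_mul _ _ _
    _ ≤ ∑ y ∈ G, ∏ i, q (y i) := by
        refine Finset.sum_le_sum (fun y hy => ?_)
        rw [hG, Finset.mem_filter] at hy
        have h5 := hy.2.2
        push Not at h5
        calc _ ≤ (∏ i, V i (y i)) *
              Real.exp (∑ i, -Real.log (P (x i) (y i) / q (y i))) := by
              refine mul_le_mul_of_nonneg_left (Real.exp_le_exp.mpr ?_) (hVn y)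
              rw [Finset.sum_neg_distrib]; linarith
          _ = ∏ i, (V i (y i) * Real.exp (-Real.log (P (x i) (y i) / q (y i)))) := by
              rw [Real.exp_sum, Finset.prod_mul_distrib]
          _ ≤ _ := Finset.prod_le_prod
              (fun i _ => mul_nonneg (hV0 _ _) (Real.exp_pos _).le) (fun i _ => hfac _ _)
    _ ≤ _ := by
        refine Finset.sum_le_sum_of_subset_of_nonneg ?_
          (fun y _ _ => Finset.prod_nonneg (fun i _ => (hq0 _).le))
        intro y hy
        rw [hG, Finset.mem_filter] at hy
        rw [Finset.mem_filter]
        exact ⟨hy.1, hy.2.1⟩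

open Classical in
lemma mar_point {J K n : ℕ} (hn : 0 < n) (hK : 0 < K) (ρmax : ℝ) (hρmax : 0 < ρmax) (d : ℝ)
    (hd : 0 < d) (ρ : Fin J → Fin K → ℝ) (hρ : IsDistMeasure ρmax ρ)
    (hlog : 1 ≤ Real.log n) (hn1 : 2 * ρmax ≤ d * Real.sqrt n)
    (hn2 : d * K ≤ 2 * ρmax * Real.sqrt n)
    (W : (Fin n → Fin K) → ℝ)
    (hW : ∀ q : Fin K → ℝ, IsProb q → ∀ y,
        Real.exp (-K) / ((n : ℝ) + 1) ^ K * ∏ i, q (y i) ≤ W y)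
    (p : Fin J → ℝ) (hp : IsProb p) (Q : Fin J → Fin K → ℝ) (hQ : IsCondProb Q)
    (hQd : avgDist p Q ρ ≤ d) (x : Fin n → Fin J) (hx : ∀ i, p (x i) ≠ 0) :
    -Real.log (∑ y ∈ Finset.univ.filter (fun y : Fin n → Fin K => nDist ρ x y ≤ d), W y) ≤
      K + K * Real.log (n + 1) + Real.log 2 +
      ∑ i, ∑ k, Q (x i) k * Real.log (Q (x i) k / ∑ j', p j' * Q j' k) +
      (|∑ i, ∑ k, Q (x i) k * ρ (x i) k - n * avgDist p Q ρ| + 2 * ρmax * Real.sqrt n) / d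
        * Real.log K + (32 * K + 8) * Real.sqrt n * Real.log n := by
  have hn' : (0 : ℝ) < n := by exact_mod_cast hn
  have hK' : (0 : ℝ) < K := by exact_mod_cast hK
  have hK1 : (1 : ℝ) ≤ K := by exact_mod_cast hK
  set sn := Real.sqrt n with hsn
  have hsn0 : 0 < sn := Real.sqrt_pos.mpr hn'
  have hsn2 : sn ^ 2 = n := Real.sq_sqrt hn'.le
  set q0 : Fin K → ℝ := fun k => ∑ j', p j' * Q j' k with hq0
  have hq0p : IsProb q0 := by
    refine ⟨fun k => Finset.sum_nonneg (fun j _ => mul_nonneg (hp.1 j) ((hQ j).1 k)), ?_⟩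
    simp only [hq0]
    rw [Finset.sum_comm]
    simp only [← Finset.mul_sum, (hQ _).2, mul_one, hp.2]
  have hac : ∀ i k, q0 k = 0 → Q (x i) k = 0 := by
    intro i k h
    have := (Finset.sum_eq_zero_iff_of_nonneg
      (fun j _ => mul_nonneg (hp.1 j) ((hQ j).1 k))).mp h (x i) (Finset.mem_univ _)
    exact (mul_eq_zero.mp this).resolve_left (hx i)
  set s := |∑ i, ∑ k, Q (x i) k * ρ (x i) k - n * avgDist p Q ρ| with hs
  have hs0 : 0 ≤ s := abs_nonneg _
  -- the mixing weight
  set lam : ℝ := (s + 2 * ρmax * sn) / (n * d + s) with hlam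
  have hden : 0 < n * d + s := by positivity
  have hlam0 : 0 < lam := by positivity
  have hnd : 2 * ρmax * sn ≤ n * d := by
    rw [← hsn2]; nlinarith
  have hlam1 : lam ≤ 1 := by
    rw [hlam, div_le_one hden]; linarith
  have hlamU : n * lam ≤ (s + 2 * ρmax * sn) / d := by
    rw [hlam, le_div_iff₀ hd, mul_div_assoc', div_mul_eq_mul_div, div_le_iff₀ hden]
    have : 0 ≤ (s + 2 * ρmax * sn) * s := by positivity
    nlinarith
  have hlamL : K / n ≤ lam := by
    rw [hlam, div_le_div_iff₀ hn' hden]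
    have h1 : (K : ℝ) ≤ n := by
      have h3 : d * K ≤ d * n := by linarith
      exact le_of_mul_le_mul_left h3 hd
    have h2 : (K : ℝ) * (n * d) ≤ 2 * ρmax * sn * n := by nlinarith
    nlinarith
  choose k0 hk0 using hρ.2
  let Q0 : Fin J → Fin K → ℝ := fun j k => if k = k0 j then 1 else 0
  have hQ0 : IsCondProb Q0 := by
    intro j
    refine ⟨fun k => ?_, by simp [Q0]⟩
    simp only [Q0]; split_ifs <;> norm_num
  let P : Fin J → Fin K → ℝ := fun j k => (1 - lam) * Q j k + lam * Q0 j k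
  have hP : IsCondProb P := by
    intro j
    refine ⟨fun k => add_nonneg (mul_nonneg (by linarith) ((hQ j).1 k))
      (mul_nonneg hlam0.le ((hQ0 j).1 k)), ?_⟩
    simp only [P]
    rw [Finset.sum_add_distrib, ← Finset.mul_sum, ← Finset.mul_sum, (hQ j).2, (hQ0 j).2]
    ring
  let q : Fin K → ℝ := fun k => (1 - lam) * q0 k + lam / K
  have hqL0 : ∀ k, lam / K ≤ q k := fun k => by
    have := mul_nonneg (sub_nonneg.mpr hlam1) (hq0p.1 k)
    simp only [q]; linarith
  have hqpos : ∀ k, 0 < q k := fun k => lt_of_lt_of_le (by positivity) (hqL0 k)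
  have hqp : IsProb q := by
    refine ⟨fun k => (hqpos k).le, ?_⟩
    simp only [q]
    rw [Finset.sum_add_distrib, ← Finset.mul_sum, hq0p.2]
    simp
    field_simp
    ring
  have hq1 : ∀ k, q k ≤ 1 := fun k => by
    rw [← hqp.2]
    exact Finset.single_le_sum (f := q) (fun k _ => hqp.1 k) (Finset.mem_univ k)
  have hqL : ∀ k, -Real.log n ≤ Real.log (q k) := by
    intro k
    rw [← Real.log_inv]
    refine Real.log_le_log (by positivity) (le_trans ?_ (hqL0 k))
    rw [le_div_iff₀ hK']
    calc _ = (K : ℝ) / n := by field_simp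
      _ ≤ lam := hlamL
  have hxd : ∑ i, ∑ k, P (x i) k * ρ (x i) k ≤ n * d - 2 * ρmax * Real.sqrt n := by
    have h1 : ∀ i, ∑ k, P (x i) k * ρ (x i) k = (1 - lam) * ∑ k, Q (x i) k * ρ (x i) k := by
      intro i
      have h2 : ∑ k, Q0 (x i) k * ρ (x i) k = 0 := by simp [Q0, hk0]
      calc _ = (1 - lam) * ∑ k, Q (x i) k * ρ (x i) k + lam * ∑ k, Q0 (x i) k * ρ (x i) k := by
            rw [Finset.mul_sum, Finset.mul_sum, ← Finset.sum_add_distrib]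
            exact Finset.sum_congr rfl (fun k _ => by simp only [P]; ring)
        _ = _ := by rw [h2]; ring
    simp only [h1]
    rw [← Finset.mul_sum]
    have h3 : ∑ i, ∑ k, Q (x i) k * ρ (x i) k ≤ n * d + s := by
      have := le_abs_self (∑ i, ∑ k, Q (x i) k * ρ (x i) k - n * avgDist p Q ρ)
      nlinarith
    calc _ ≤ (1 - lam) * (n * d + s) := mul_le_mul_of_nonneg_left h3 (by linarith)
      _ = n * d - 2 * ρmax * sn := by
          have : lam * (n * d + s) = s + 2 * ρmax * sn := by
            rw [hlam]; field_simp
          linarith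
  set t : ℝ := (32 * K + 8) * sn * Real.log n with ht
  have hlog0 : 0 < Real.log n := by linarith
  have ht0 : 0 < t := by positivity
  have htv : 4 * (n * (8 * K + 2 * (Real.log n) ^ 2)) ≤ t ^ 2 := by
    rw [ht, mul_pow, mul_pow, hsn2]
    have h1 : 1 ≤ (Real.log n) ^ 2 := by nlinarith
    have h2 : 4 * (8 * K + 2 * (Real.log n) ^ 2) ≤ (32 * K + 8) ^ 2 * (Real.log n) ^ 2 := by
      have h3 : 32 * (K : ℝ) * 1 ≤ 32 * K * (Real.log n) ^ 2 :=
        mul_le_mul_of_nonneg_left h1 (by positivity)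
      have h4 : (32 * (K : ℝ) + 8) ≤ (32 * K + 8) ^ 2 := by nlinarith
      have h5 := mul_le_mul_of_nonneg_right h4 (sq_nonneg (Real.log n))
      linarith
    have := mul_le_mul_of_nonneg_left h2 hn'.le
    linarith
  have hball := mar_ball hn ρmax hρmax d ρ hρ P hP q hqpos hq1 (Real.log n) hqL x hxd t ht0 htv
  have hmean : ∑ i, ∑ k, P (x i) k * Real.log (P (x i) k / q k) ≤
      ∑ i, ∑ k, Q (x i) k * Real.log (Q (x i) k / q0 k) +
        (s + 2 * ρmax * sn) / d * Real.log K := by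
    calc _ ≤ ∑ i, (∑ k, Q (x i) k * Real.log (Q (x i) k / q0 k) + lam * Real.log K) :=
          Finset.sum_le_sum (fun i _ => mar_mix hK (Q (x i)) q0 (Q0 (x i)) (hQ _) hq0p (hQ0 _)
            (hac i) lam hlam0 hlam1)
      _ ≤ _ := by
          rw [Finset.sum_add_distrib]
          simp only [Finset.sum_const, Finset.card_univ, Fintype.card_fin, nsmul_eq_mul]
          have := mul_le_mul_of_nonneg_right hlamU (Real.log_nonneg hK1)
          linarith
  have hWl : Real.exp (-K) / ((n : ℝ) + 1) ^ K * (1 / 2 *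
      Real.exp (-(∑ i, ∑ k, P (x i) k * Real.log (P (x i) k / q k)) - t)) ≤
      ∑ y ∈ Finset.univ.filter (fun y : Fin n → Fin K => nDist ρ x y ≤ d), W y := by
    refine le_trans (mul_le_mul_of_nonneg_left hball (by positivity)) ?_
    rw [Finset.mul_sum]
    exact Finset.sum_le_sum (fun y _ => hW q hqp y)
  have hfin := Real.log_le_log (by positivity) hWl
  rw [Real.log_mul (by positivity) (by positivity), Real.log_div (by positivity) (by positivity),
    Real.log_mul (by positivity) (by positivity), Real.log_exp, Real.log_exp, Real.log_pow,
    one_div, Real.log_inv] at hfin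
  linarith

lemma mar_expect {J K n : ℕ} (hn : 0 < n) (hK : 0 < K) (ρmax : ℝ) (hρmax : 0 < ρmax) (d : ℝ)
    (hd : 0 < d) (ρ : Fin J → Fin K → ℝ) (hρ : IsDistMeasure ρmax ρ)
    (p : Fin J → ℝ) (hp : IsProb p) (Q : Fin J → Fin K → ℝ) (hQ : IsCondProb Q)
    (C t : ℝ) (len : (Fin n → Fin J) → ℝ)
    (hlen : ∀ x, (∀ i, p (x i) ≠ 0) → len x ≤ C +
      ∑ i, ∑ k, Q (x i) k * Real.log (Q (x i) k / ∑ j', p j' * Q j' k) +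
      (|∑ i, ∑ k, Q (x i) k * ρ (x i) k - n * avgDist p Q ρ| + t) / d
        * Real.log K) :
    ∑ x, prodProb p x * len x ≤ C + n * mutualInfo p Q +
      (ρmax * Real.sqrt n + t) / d * Real.log K := by
  have hn' : (0 : ℝ) < n := by exact_mod_cast hn
  have hK1 : (1 : ℝ) ≤ K := by exact_mod_cast hK
  have hpp : ∀ x : Fin n → Fin J, 0 ≤ prodProb p x :=
    fun x => Finset.prod_nonneg (fun i _ => hp.1 _)
  set D : Fin J → ℝ := fun j => ∑ k, Q j k * Real.log (Q j k / ∑ j', p j' * Q j' k) with hD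
  set Δ : Fin J → ℝ := fun j => ∑ k, Q j k * ρ j k with hΔ
  have hav : avgDist p Q ρ = ∑ j, p j * Δ j := by
    simp only [avgDist, hΔ, Finset.mul_sum, mul_assoc]
  have hmi : mutualInfo p Q = ∑ j, p j * D j := by
    simp only [mutualInfo, hD, Finset.mul_sum, mul_assoc]
  have h1 : ∑ x : Fin n → Fin J, prodProb p x = 1 :=
    mar_sum_one (fun _ : Fin n => p) (fun _ => hp.2)
  have h2 : ∑ x : Fin n → Fin J, prodProb p x * ∑ i, D (x i) = n * mutualInfo p Q := by
    have := mar_sum_lin (fun _ : Fin n => p) (fun _ => D) (fun _ => hp.2)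
    rw [hmi]
    simpa [prodProb] using this
  have hΔ0 : ∀ j, 0 ≤ Δ j := fun j =>
    Finset.sum_nonneg (fun k _ => mul_nonneg ((hQ j).1 k) (hρ.1 j k).1)
  have hΔ1 : ∀ j, Δ j ≤ ρmax := fun j => by
    calc _ ≤ ∑ k, Q j k * ρmax := Finset.sum_le_sum (fun k _ =>
          mul_le_mul_of_nonneg_left (hρ.1 j k).2 ((hQ j).1 k))
      _ = _ := by rw [← Finset.sum_mul, (hQ j).2, one_mul]
  have h3 : ∑ x : Fin n → Fin J, prodProb p x * |∑ i, Δ (x i) - n * avgDist p Q ρ| ≤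
      ρmax * Real.sqrt n := by
    have := mar_abs (fun _ : Fin n => p) (fun _ => Δ) (fun _ => hp.1) (fun _ => hp.2) (ρmax ^ 2)
      (by
        intro i
        calc _ ≤ ∑ b, p b * ρmax ^ 2 := Finset.sum_le_sum (fun b _ =>
              mul_le_mul_of_nonneg_left (pow_le_pow_left₀ (hΔ0 b) (hΔ1 b) 2) (hp.1 b))
          _ = _ := by rw [← Finset.sum_mul, hp.2, one_mul])
      (ρmax * Real.sqrt n) (by positivity)
      (by rw [mul_pow, Real.sq_sqrt hn'.le]; linarith)
    rw [hav]
    simpa [prodProb] using this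
  have hmain : ∑ x, prodProb p x * len x ≤ ∑ x : Fin n → Fin J, (C * prodProb p x +
      prodProb p x * ∑ i, D (x i) +
      Real.log K / d * (prodProb p x * |∑ i, Δ (x i) - n * avgDist p Q ρ|) +
      t / d * Real.log K * prodProb p x) := by
    refine Finset.sum_le_sum (fun x _ => ?_)
    by_cases hx : ∀ i, p (x i) ≠ 0
    · refine le_trans (mul_le_mul_of_nonneg_left (hlen x hx) (hpp x)) (le_of_eq ?_)
      ring
    · push Not at hx
      obtain ⟨i, hi⟩ := hx
      have : prodProb p x = 0 := Finset.prod_eq_zero (Finset.mem_univ i) hi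
      rw [this]; simp
  refine le_trans hmain ?_
  rw [Finset.sum_add_distrib, Finset.sum_add_distrib, Finset.sum_add_distrib, ← Finset.mul_sum,
    ← Finset.mul_sum, ← Finset.mul_sum, h1, h2]
  have h4 := mul_le_mul_of_nonneg_left h3 (div_nonneg (Real.log_nonneg hK1) hd.le)
  have : (ρmax * Real.sqrt n + t) / d * Real.log K =
    Real.log K / d * (ρmax * Real.sqrt n) + t / d * Real.log K := by ring
  rw [this]
  linarith

/-- Corollary 4: fix `d > 0` and `ρ ∈ D`. The minimax redundancy
over deterministic (not necessarily prefix) `d`-semifaithful codes,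
`inf_{codes} sup_{p ∈ P(A)} [(ln 2/n) E_p[l(f_n(φ_n(X^n)))] − R(p,d,ρ)]`,
is `O((ln n)^{3/2}/√n)` as `n → ∞`. -/
theorem minimax_arbitrary_redundancy_rate (J K : ℕ) (hJ : 0 < J) (hK : 0 < K)
    (ρmax : ℝ) (hρmax : 0 < ρmax) (d : ℝ) (hd : 0 < d)
    (ρ : Fin J → Fin K → ℝ) (hρ : IsDistMeasure ρmax ρ) :
    ∃ c : ℝ, 0 < c ∧ ∃ N : ℕ, ∀ n : ℕ, N ≤ n →
      |sInf { r : ℝ |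
          ∃ (φ : (Fin n → Fin J) → (Fin n → Fin K))
            (f : (Fin n → Fin K) → List Bool)
            (g : List Bool → (Fin n → Fin K)),
            (∀ x, nDist ρ x (φ x) ≤ d) ∧
            (∀ x, g (f (φ x)) = φ x) ∧
            r = sSup { v : ℝ | ∃ p : Fin J → ℝ, IsProb p ∧
                  v = (Real.log 2 / n) *
                        (∑ x : Fin n → Fin J, prodProb p x * ((f (φ x)).length : ℝ))
                      - RD p d ρ } }|
        ≤ c * (Real.log n) ^ ((3 : ℝ) / 2) / Real.sqrt n := by
  classical
  have hJ' : (1 : ℝ) ≤ J := by exact_mod_cast hJ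
  have hK' : (1 : ℝ) ≤ K := by exact_mod_cast hK
  refine ⟨3 * J + 1 + K + 2 * K + 1 + (32 * K + 8) + 1 + 3 * ρmax / d * K, by positivity,
    max 3 (max ⌈(2 * ρmax / d) ^ 2⌉₊ ⌈(d * K / (2 * ρmax)) ^ 2⌉₊), fun n hN => ?_⟩
  have hn3 : 3 ≤ n := le_trans (le_max_left _ _) hN
  have hNa : ⌈(2 * ρmax / d) ^ 2⌉₊ ≤ n :=
    le_trans (le_trans (le_max_left _ _) (le_max_right _ _)) hN
  have hNb : ⌈(d * K / (2 * ρmax)) ^ 2⌉₊ ≤ n :=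
    le_trans (le_trans (le_max_right _ _) (le_max_right _ _)) hN
  have hn : 0 < n := by omega
  have hn3' : (3 : ℝ) ≤ n := by exact_mod_cast hn3
  have hn' : (0 : ℝ) < n := by linarith
  have hlog : 1 ≤ Real.log n := by
    rw [Real.le_log_iff_exp_le hn']
    linarith [Real.exp_one_lt_three]
  have hn1 : 2 * ρmax ≤ d * Real.sqrt n := by
    have := Real.le_sqrt_of_sq_le (Nat.ceil_le.mp hNa)
    rw [div_le_iff₀ hd] at this
    linarith
  have hn2 : d * K ≤ 2 * ρmax * Real.sqrt n := by
    have := Real.le_sqrt_of_sq_le (Nat.ceil_le.mp hNb)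
    rw [div_le_iff₀ (by positivity)] at this
    linarith
  set c : ℝ := 3 * J + 1 + K + 2 * K + 1 + (32 * K + 8) + 1 + 3 * ρmax / d * K with hc
  have hc0 : 0 < c := by positivity
  have hsn0 : 0 < Real.sqrt n := Real.sqrt_pos.mpr hn'
  have hsn1 : 1 ≤ Real.sqrt n := by
    rw [← Real.sqrt_one]; exact Real.sqrt_le_sqrt (by linarith)
  have hlb : ∀ (φ : (Fin n → Fin J) → (Fin n → Fin K)) (f : (Fin n → Fin K) → List Bool),
      0 ≤ sSup { v : ℝ | ∃ p : Fin J → ℝ, IsProb p ∧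
                  v = (Real.log 2 / n) *
                        (∑ x : Fin n → Fin J, prodProb p x * ((f (φ x)).length : ℝ))
                      - RD p d ρ } := by
    intro φ f
    refine Real.sSup_nonneg' ?_
    let j0 : Fin J := ⟨0, hJ⟩
    let p : Fin J → ℝ := fun j => if j = j0 then 1 else 0
    have hp : IsProb p := by
      refine ⟨fun j => ?_, by simp [p]⟩
      simp only [p]; split_ifs <;> norm_num
    refine ⟨_, ⟨p, hp, rfl⟩, ?_⟩
    have hRD : RD p d ρ ≤ 0 := by
      obtain ⟨k0, hk0⟩ := hρ.2 j0
      let Q : Fin J → Fin K → ℝ := fun _ k => if k = k0 then 1 else 0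
      refine Real.sInf_nonpos' ⟨0, ⟨Q, ?_, ?_, ?_⟩, le_rfl⟩
      · intro j
        refine ⟨fun k => ?_, by simp [Q]⟩
        simp only [Q]; split_ifs <;> norm_num
      · simp [avgDist, p, Q, hk0, hd.le]
      · simp [mutualInfo, p, Q]
    have h0 : 0 ≤ (Real.log 2 / n) *
        (∑ x : Fin n → Fin J, prodProb p x * ((f (φ x)).length : ℝ)) := by
      refine mul_nonneg (div_nonneg (Real.log_nonneg (by norm_num)) hn'.le)
        (Finset.sum_nonneg (fun x _ => mul_nonneg
          (Finset.prod_nonneg (fun i _ => hp.1 _)) (by positivity)))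
    linarith
  rw [abs_of_nonneg (by
    refine Real.sInf_nonneg ?_
    rintro r ⟨φ, f, g, -, -, rfl⟩
    exact hlb φ f)]
  obtain ⟨W, hW0, hW1, hWq⟩ := mar_univ n K hn hK
  have hne : Nonempty (Fin n → Fin J) := ⟨fun _ => ⟨0, hJ⟩⟩
  choose k0 hk0 using hρ.2
  have hpos : ∀ x : Fin n → Fin J,
      0 < ∑ y ∈ Finset.univ.filter (fun y : Fin n → Fin K => nDist ρ x y ≤ d), W y := by
    intro x
    refine Finset.sum_pos (fun y _ => hW0 y) ⟨fun i => k0 (x i), ?_⟩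
    refine Finset.mem_filter.mpr ⟨Finset.mem_univ _, ?_⟩
    simp [nDist, hk0, hd.le]
  have hM1 : (1 : ℝ) ≤ n * J := by nlinarith
  have hMc : Real.log (Fintype.card (Fin n → Fin J)) ≤ n * J := by
    simp only [Fintype.card_fun, Fintype.card_fin]
    push_cast
    rw [Real.log_pow]
    have := Real.log_le_sub_one_of_pos (x := (J : ℝ)) (by linarith)
    exact mul_le_mul_of_nonneg_left (by linarith) hn'.le
  obtain ⟨φ, f, g, hφ, hg, hlen⟩ := mar_code (fun (x : Fin n → Fin J) (y : Fin n → Fin K) =>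
    nDist ρ x y ≤ d) W (fun y => (hW0 y).le) hW1 hpos (n * J) hM1 hMc
  refine le_trans (csInf_le ⟨0, ?_⟩ ⟨φ, f, g, hφ, hg, rfl⟩) ?_
  · rintro r ⟨φ, f, g, -, -, rfl⟩
    exact hlb φ f
  refine Real.sSup_le ?_ (by positivity)
  rintro v ⟨p, hp, rfl⟩
  have hRDne : { r | ∃ Q, IsCondProb Q ∧ avgDist p Q ρ ≤ d ∧ r = mutualInfo p Q }.Nonempty := by
    let Q : Fin J → Fin K → ℝ := fun j k => if k = k0 j then 1 else 0
    refine ⟨_, Q, ?_, ?_, rfl⟩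
    · intro j
      refine ⟨fun k => ?_, by simp [Q]⟩
      simp only [Q]; split_ifs <;> norm_num
    · simp [avgDist, Q, hk0, hd.le]
  obtain ⟨_, ⟨Q, hQ, hQd, rfl⟩, hI⟩ := Real.lt_sInf_add_pos hRDne
    (ε := 1 / Real.sqrt n) (by positivity)
  change mutualInfo p Q < RD p d ρ + _ at hI
  have hE := mar_expect hn hK ρmax hρmax d hd ρ hρ p hp Q hQ
    (Real.log (3 * (n * J)) + K + K * Real.log (n + 1) + Real.log 2 +
      (32 * K + 8) * Real.sqrt n * Real.log n) (2 * ρmax * Real.sqrt n)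
    (fun x => Real.log 2 * (f (φ x)).length) (by
      intro x hx
      have h1 := mar_point hn hK ρmax hρmax d hd ρ hρ hlog hn1 hn2 W hWq p hp Q hQ hQd x hx
      have h2 := hlen x
      linarith)
  have hE2 : ∑ x : Fin n → Fin J, prodProb p x * (Real.log 2 * (f (φ x)).length) =
      Real.log 2 * ∑ x : Fin n → Fin J, prodProb p x * ((f (φ x)).length : ℝ) := by
    rw [Finset.mul_sum]
    exact Finset.sum_congr rfl (fun x _ => by ring)
  rw [hE2] at hE
  set T := ∑ x : Fin n → Fin J, prodProb p x * ((f (φ x)).length : ℝ) with hT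
  set S := Real.sqrt n * Real.log n with hS
  have hsq : Real.sqrt n * Real.sqrt n = n := Real.mul_self_sqrt hn'.le
  have hSs : Real.sqrt n ≤ S := le_mul_of_one_le_right hsn0.le hlog
  have hSl : Real.log n ≤ S := le_mul_of_one_le_left (by linarith) hsn1
  have hS1 : 1 ≤ S := by linarith
  have e1 : Real.log (3 * (n * J)) ≤ (3 * J + 1) * S := by
    have : (3 : ℝ) * (n * J) = (3 * J) * n := by ring
    rw [this, Real.log_mul (by positivity) (by positivity)]
    have := Real.log_le_sub_one_of_pos (x := 3 * (J : ℝ)) (by positivity)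
    have h3 : 3 * (J : ℝ) * 1 ≤ 3 * J * S := mul_le_mul_of_nonneg_left hS1 (by positivity)
    linarith
  have e2 : (K : ℝ) ≤ K * S := le_mul_of_one_le_right (by positivity) hS1
  have e3 : K * Real.log (n + 1) ≤ 2 * K * S := by
    have h1 : Real.log (n + 1) ≤ 2 * Real.log n := by
      have : Real.log ((n : ℝ) ^ 2) = 2 * Real.log n := by rw [Real.log_pow]; norm_num
      rw [← this]
      exact Real.log_le_log (by positivity) (by nlinarith)
    calc K * Real.log (n + 1) ≤ K * (2 * S) :=
          mul_le_mul_of_nonneg_left (by linarith) (by positivity)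
      _ = 2 * K * S := by ring
  have e4 : Real.log 2 ≤ S := by
    have := Real.log_two_lt_d9
    linarith
  have e5 : n * mutualInfo p Q ≤ n * RD p d ρ + S := by
    have h1 : n * (1 / Real.sqrt n) = Real.sqrt n := by
      nth_rewrite 1 [← hsq]
      field_simp
    have h2 := mul_le_mul_of_nonneg_left hI.le hn'.le
    rw [mul_add, h1] at h2
    linarith
  have e6 : (ρmax * Real.sqrt n + 2 * ρmax * Real.sqrt n) / d * Real.log K ≤
      3 * ρmax / d * K * S := by
    have h1 : Real.log K ≤ K := by
      have := Real.log_le_sub_one_of_pos (x := (K : ℝ)) (by linarith)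
      linarith
    have h2 : (ρmax * Real.sqrt n + 2 * ρmax * Real.sqrt n) / d * Real.log K =
      3 * ρmax / d * (Real.log K * Real.sqrt n) := by ring
    rw [h2, mul_assoc]
    refine mul_le_mul_of_nonneg_left ?_ (by positivity)
    exact mul_le_mul h1 hSs hsn0.le (by linarith)
  have hfin : Real.log 2 * T ≤ n * RD p d ρ + c * S := by
    rw [hc]
    have : (32 * (K : ℝ) + 8) * Real.sqrt n * Real.log n = (32 * K + 8) * S := by
      rw [hS]; ring
    rw [this] at hE
    linarith
  have hpow : Real.log n ≤ (Real.log n) ^ ((3 : ℝ) / 2) := by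
    nth_rewrite 1 [← Real.rpow_one (Real.log n)]
    exact Real.rpow_le_rpow_of_exponent_le hlog (by norm_num)
  have h7 : Real.log 2 / n * T - RD p d ρ ≤ c * S / n := by
    have h8 : Real.log 2 / n * T - RD p d ρ = (Real.log 2 * T - n * RD p d ρ) / n := by
      field_simp
    rw [h8]
    exact div_le_div_of_nonneg_right (by linarith) hn'.le
  refine le_trans h7 ?_
  have h9 : c * S / n = c * Real.log n / Real.sqrt n := by
    rw [hS, div_eq_div_iff hn'.ne' hsn0.ne']
    calc _ = c * Real.log n * (Real.sqrt n * Real.sqrt n) := by ring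
      _ = _ := by rw [hsq]
  rw [h9]
  exact div_le_div_of_nonneg_right (mul_le_mul_of_nonneg_left hpow hc0.le) hsn0.le
end
end

section
/- Let A = B = {0,1} with distortion measure ρ(0,0) = ρ(1,1) = 0 and ρ(0,1) = ρ(1,0) = ρ_max > 0, let d ∈ (0, ρ_max/2), set d̄ = d/ρ_max, and let p be the Bernoulli(d̄) distribution on A. Then for every n satisfying 2d̄ + 3√(d̄(1−d̄)/n) < 1, E_p[R(T,d,ρ)] − R(p,d,ρ) ≥ [ √(d̄(1−d̄)/n)·ln((1−d̄)/d̄) − 1/(2n) ]⁺ · [ Φ(2) − Φ(1) − ((1−d̄)² + d̄²)/√(n·d̄(1−d̄)) ]⁺, where x⁺ = max(x,0) and Φ is the standard normal CDF. -/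
open Filter MeasureTheory
open scoped BigOperators

noncomputable section

variable {A B : Type*}

/-- The standard normal CDF `Φ`. -/
def stdNormalCDF (x : ℝ) : ℝ :=
  ∫ t in Set.Iic x, Real.exp (-(t ^ 2) / 2) / Real.sqrt (2 * Real.pi)

/-- The binary Hamming-type distortion measure with off-diagonal value `ρmax`. -/
def binDist (ρmax : ℝ) : Fin 2 → Fin 2 → ℝ :=
  fun j k => if j = k then 0 else ρmax

/-- The Bernoulli(`q`) distribution on `{0,1}`, with `p(1) = q`. -/
def bern (q : ℝ) : Fin 2 → ℝ :=
  fun j => if j = 1 then q else 1 - q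

lemma aux_term (w u : ℝ) (hw : 0 ≤ w) (hu : 0 ≤ u) (h : 0 < w → 0 < u) :
    w - u ≤ w * Real.log (w / u) := by
  rcases hw.eq_or_lt with h0 | h0
  · rw [← h0]; simpa using hu
  · have hu' := h h0
    have h1 := Real.one_sub_inv_le_log_of_pos (div_pos h0 hu')
    have h2 := mul_le_mul_of_nonneg_left h1 hw
    have h3 : w * (1 - (w / u)⁻¹) = w - u := by field_simp
    linarith

/-- Variational lower bound for the mutual information. -/
lemma aux_mi (t : Fin 2 → ℝ) (ht : IsProb t) (Q : Fin 2 → Fin 2 → ℝ) (hQ : IsCondProb Q)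
    (V : Fin 2 → Fin 2 → ℝ) (hV : ∀ j k, 0 ≤ V j k) (hV1 : ∀ k, ∑ j, V j k = 1)
    (hpos : ∀ j k, 0 < t j → 0 < V j k) :
    ∑ j, ∑ k, t j * Q j k * Real.log (V j k / t j) ≤ mutualInfo t Q := by
  set r : Fin 2 → ℝ := fun k => ∑ j', t j' * Q j' k with hr
  have hr0 : ∀ k, 0 ≤ r k := fun k =>
    Finset.sum_nonneg fun j _ => mul_nonneg (ht.1 j) ((hQ j).1 k)
  have key : ∀ j k, t j * Q j k - r k * V j k ≤
      t j * Q j k * Real.log (Q j k / r k) - t j * Q j k * Real.log (V j k / t j) := by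
    intro j k
    have hw0 : 0 ≤ t j * Q j k := mul_nonneg (ht.1 j) ((hQ j).1 k)
    rcases hw0.eq_or_lt with h0 | h0
    · rw [← h0]
      have := mul_nonneg (hr0 k) (hV j k)
      simpa using this
    · have htj : 0 < t j := lt_of_le_of_ne (ht.1 j) (fun h => by rw [← h] at h0; simp at h0)
      have hQj : 0 < Q j k := lt_of_le_of_ne ((hQ j).1 k) (fun h => by rw [← h] at h0; simp at h0)
      have hrk : 0 < r k := lt_of_lt_of_le h0
        (Finset.single_le_sum (f := fun j' => t j' * Q j' k)
          (fun j' _ => mul_nonneg (ht.1 j') ((hQ j').1 k)) (Finset.mem_univ j))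
      have hVj := hpos j k htj
      have := aux_term (t j * Q j k) (r k * V j k) hw0 (by positivity) (fun _ => by positivity)
      have e : Real.log (t j * Q j k / (r k * V j k)) =
          Real.log (Q j k / r k) - Real.log (V j k / t j) := by
        rw [← Real.log_div (by positivity) (by positivity)]
        congr 1
        field_simp
      rw [e, mul_sub] at this
      exact this
  have hs : ∑ j, ∑ k, (t j * Q j k - r k * V j k) ≤ ∑ j, ∑ k,
      (t j * Q j k * Real.log (Q j k / r k) - t j * Q j k * Real.log (V j k / t j)) :=
    Finset.sum_le_sum fun j _ => Finset.sum_le_sum fun k _ => key j k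
  have h0 : ∑ j, ∑ k, (t j * Q j k - r k * V j k) = 0 := by
    simp only [Finset.sum_sub_distrib]
    rw [Finset.sum_comm (f := fun j k => r k * V j k), Finset.sum_comm (f := fun j k => t j * Q j k)]
    simp only [← Finset.mul_sum, hV1, mul_one]
    simp [hr]
  rw [h0] at hs
  simp only [Finset.sum_sub_distrib] at hs
  unfold mutualInfo
  linarith

lemma aux_nonneg (t : Fin 2 → ℝ) (ht : IsProb t) (Q : Fin 2 → Fin 2 → ℝ) (hQ : IsCondProb Q) :
    0 ≤ mutualInfo t Q := by
  refine le_trans (le_of_eq ?_) (aux_mi t ht Q hQ (fun j _ => t j) (fun j _ => ht.1 j)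
    (fun _ => ht.2) (fun j _ h => h))
  symm
  refine Finset.sum_eq_zero fun j _ => Finset.sum_eq_zero fun k _ => ?_
  by_cases h : t j = 0 <;> simp [h]

lemma aux_RD_nonneg (t : Fin 2 → ℝ) (ht : IsProb t) (d : ℝ) (ρ : Fin 2 → Fin 2 → ℝ) :
    0 ≤ RD t d ρ := by
  apply Real.sInf_nonneg
  rintro r ⟨Q, hQ, _, rfl⟩
  exact aux_nonneg t ht Q hQ

lemma aux_RD_lower (t : Fin 2 → ℝ) (ht : IsProb t) (m q : ℝ) (hm : 0 < m) (hq : 0 < q)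
    (hq2 : q < 1 / 2) :
    Real.binEntropy (t 1) - Real.binEntropy q ≤ RD t (q * m) (binDist m) := by
  apply le_csInf
  · refine ⟨_, fun j k => if j = k then 1 else 0, ?_, ?_, rfl⟩
    · intro j
      exact ⟨fun a => by positivity, by simp⟩
    · have : 0 ≤ q * m := by positivity
      simpa [avgDist, binDist] using this
  · rintro r ⟨Q, hQ, hD, rfl⟩
    have h := aux_mi t ht Q hQ (fun j k => if j = k then 1 - q else q)
      (fun j k => by split_ifs <;> linarith) (fun k => by fin_cases k <;> simp)
      (fun j k _ => by split_ifs <;> linarith)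
    refine le_trans ?_ h
    have hl : ∀ j k, t j * Q j k * Real.log ((if j = k then 1 - q else q) / t j) =
        t j * Q j k * Real.log (if j = k then 1 - q else q) - t j * Real.log (t j) * Q j k := by
      intro j k
      by_cases h0 : t j = 0
      · simp [h0]
      · rw [Real.log_div _ h0]
        · ring
        · split_ifs <;> linarith
    simp only [hl]
    have hQ0 := (hQ 0).2
    have hQ1 := (hQ 1).2
    have htt := ht.2
    simp only [Fin.sum_univ_two, avgDist, binDist] at hQ0 hQ1 htt hD ⊢
    simp at hD ⊢
    have hD' : t 0 * Q 0 1 + t 1 * Q 1 0 ≤ q := by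
      have : (t 0 * Q 0 1 + t 1 * Q 1 0) * m ≤ q * m := by linarith
      exact le_of_mul_le_mul_right this hm
    have hlog : Real.log q ≤ Real.log (1 - q) := Real.log_le_log hq (by linarith)
    rw [Real.binEntropy_eq_negMulLog_add_negMulLog_one_sub,
      Real.binEntropy_eq_negMulLog_add_negMulLog_one_sub]
    have h0 : 1 - t 1 = t 0 := by linarith
    rw [h0]
    simp only [Real.negMulLog]
    have e0 : Q 0 0 = 1 - Q 0 1 := by linarith
    have e1 : Q 1 1 = 1 - Q 1 0 := by linarith
    have e2 : t 0 = 1 - t 1 := by linarith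
    rw [e0, e1]
    have := mul_nonneg (sub_nonneg.2 hD') (sub_nonneg.2 hlog)
    have e3 : t 0 * Real.log (1 - q) + t 1 * Real.log (1 - q) = Real.log (1 - q) := by
      rw [← add_mul, htt, one_mul]
    nlinarith

lemma aux_RD_bern (m q : ℝ) (hm : 0 < m) (hq : 0 < q) (hq2 : q < 1 / 2) :
    RD (bern q) (q * m) (binDist m) ≤ 0 := by
  have hb : IsProb (bern q) := by
    constructor
    · intro a; fin_cases a <;> simp [bern] <;> linarith
    · simp [bern]
  apply csInf_le
  · refine ⟨0, ?_⟩
    rintro r ⟨Q, hQ, _, rfl⟩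
    exact aux_nonneg _ hb Q hQ
  · refine ⟨fun _ k => if k = 0 then 1 else 0, ?_, ?_, ?_⟩
    · intro j
      exact ⟨fun a => by positivity, by simp⟩
    · simp [avgDist, bern, binDist]
    · simp [mutualInfo, bern]

/-- Second-order lower bound on the entropy increment. -/
lemma aux_taylor (q δ : ℝ) (hq : 0 < q) (hδ : 0 ≤ δ) (h : q + δ ≤ 1 / 2) :
    δ * Real.log ((1 - q) / q) - δ ^ 2 / (2 * (q * (1 - q))) ≤
      Real.binEntropy (q + δ) - Real.binEntropy q := by
  rw [Real.log_div (by linarith) (by linarith)]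
  set c := Real.log (1 - q) - Real.log q with hc
  have hpq : 0 < q * (1 - q) := mul_pos hq (by linarith)
  -- first derivative
  have hG : MonotoneOn (fun x => Real.log (1 - x) - Real.log x - c + (x - q) / (q * (1 - q)))
      (Set.Icc q (1 / 2)) := by
    have hder : ∀ x ∈ Set.Icc q (1 / 2), HasDerivAt
        (fun x => Real.log (1 - x) - Real.log x - c + (x - q) / (q * (1 - q)))
        (-1 / (1 - x) - 1 / x - 0 + 1 / (q * (1 - q))) x := by
      intro x hx
      have hx0 : 0 < x := lt_of_lt_of_le hq hx.1
      have hx1 : x ≤ 1 / 2 := hx.2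
      have h1 : HasDerivAt (fun x : ℝ => 1 - x) (-1) x := by
        simpa using (hasDerivAt_id x).const_sub 1
      refine (((h1.log (by linarith)).sub ((hasDerivAt_id x).log hx0.ne')).sub
        (hasDerivAt_const x c)).add (((hasDerivAt_id x).sub_const q).div_const _)
    apply monotoneOn_of_deriv_nonneg (convex_Icc _ _)
    · exact fun x hx => (hder x hx).continuousAt.continuousWithinAt
    · exact fun x hx => (hder x (interior_subset hx)).differentiableAt.differentiableWithinAt
    · intro x hx
      have hx' := interior_subset hx
      rw [(hder x hx').deriv]
      have hx0 : 0 < x := lt_of_lt_of_le hq hx'.1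
      have hx1 : x ≤ 1 / 2 := hx'.2
      have hx2 : 0 < 1 - x := by linarith
      have e : -1 / (1 - x) - 1 / x - 0 = - (1 / (x * (1 - x))) := by
        field_simp; ring
      rw [e]
      have : 1 / (x * (1 - x)) ≤ 1 / (q * (1 - q)) := by
        apply one_div_le_one_div_of_le hpq
        nlinarith [hx'.1]
      linarith
  have hF : MonotoneOn (fun x => Real.binEntropy x - (x - q) * c
      + (x - q) ^ 2 / (2 * (q * (1 - q)))) (Set.Icc q (1 / 2)) := by
    have hder : ∀ x ∈ Set.Icc q (1 / 2), HasDerivAt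
        (fun x => Real.binEntropy x - (x - q) * c + (x - q) ^ 2 / (2 * (q * (1 - q))))
        (Real.log (1 - x) - Real.log x - 1 * c + (2 * (x - q) ^ 1 * 1) / (2 * (q * (1 - q)))) x := by
      intro x hx
      have hx0 : 0 < x := lt_of_lt_of_le hq hx.1
      have hx1 : x ≤ 1 / 2 := hx.2
      have h2 : HasDerivAt (fun x : ℝ => x - q) 1 x := (hasDerivAt_id x).sub_const q
      exact (((Real.hasDerivAt_binEntropy hx0.ne' (by linarith)).sub (h2.mul_const c)).add
        ((h2.pow 2).div_const _))
    apply monotoneOn_of_deriv_nonneg (convex_Icc _ _)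
    · exact fun x hx => (hder x hx).continuousAt.continuousWithinAt
    · exact fun x hx => (hder x (interior_subset hx)).differentiableAt.differentiableWithinAt
    · intro x hx
      have hx' := interior_subset hx
      rw [(hder x hx').deriv]
      have := hG (Set.left_mem_Icc.2 (by linarith)) hx' hx'.1
      simp only [sub_self, zero_div] at this
      have e : (2 * (x - q) ^ 1 * 1) / (2 * (q * (1 - q))) = (x - q) / (q * (1 - q)) := by
        rw [pow_one, mul_one, mul_div_mul_left _ _ two_ne_zero]
      rw [e]
      linarith
  have := hF (Set.left_mem_Icc.2 (by linarith)) (⟨by linarith, h⟩ : q + δ ∈ Set.Icc q (1 / 2))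
    (by linarith)
  simp at this
  linarith

lemma aux_concave_small (q δ L z : ℝ) (hq : 0 < q) (hδ : 0 ≤ δ) (h : q + δ ≤ 1 / 2)
    (hL : L ≤ Real.binEntropy (q + δ) - Real.binEntropy q) (hz0 : 0 ≤ z) (hz1 : z ≤ 1) :
    L * z ≤ Real.binEntropy (q + δ * z) - Real.binEntropy q := by
  have hc := Real.strictConcave_binEntropy.concaveOn.2
    (⟨by linarith, by linarith⟩ : q ∈ Set.Icc (0 : ℝ) 1)
    (⟨by linarith, by linarith⟩ : q + δ ∈ Set.Icc (0 : ℝ) 1)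
    (sub_nonneg.2 hz1) hz0 (by ring)
  simp only [smul_eq_mul] at hc
  have e : (1 - z) * q + z * (q + δ) = q + δ * z := by ring
  rw [e] at hc
  nlinarith

/-- Trapezoidal lower bound. -/
lemma aux_trap (q δ L z : ℝ) (hq : 0 < q) (hδ : 0 < δ) (h : 2 * q + 3 * δ < 1) (hL0 : 0 ≤ L)
    (hL : L ≤ Real.binEntropy (q + δ) - Real.binEntropy q) (hz0 : 0 ≤ z) (hz3 : z ≤ 3) :
    L * min (min z 1) (3 - z) ≤ Real.binEntropy (q + δ * z) - Real.binEntropy q := by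
  have hm1 : min (min z 1) (3 - z) ≤ z := (min_le_left _ _).trans (min_le_left _ _)
  have hm2 : min (min z 1) (3 - z) ≤ 1 := (min_le_left _ _).trans (min_le_right _ _)
  have hm3 : min (min z 1) (3 - z) ≤ 3 - z := min_le_right _ _
  set g := min (min z 1) (3 - z)
  have hqd : q + δ ≤ 1 / 2 := by linarith
  rcases le_total z 1 with h1 | h1
  · exact le_trans (mul_le_mul_of_nonneg_left hm1 hL0)
      (aux_concave_small q δ L z hq hδ.le hqd hL hz0 h1)
  · rcases le_total (q + δ * z) (1 - (q + δ)) with h2 | h2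
    · have := Real.strictConcave_binEntropy.concaveOn.min_le_of_mem_Icc
        (⟨by linarith, by linarith⟩ : q + δ ∈ Set.Icc (0 : ℝ) 1)
        (⟨by linarith, by linarith⟩ : 1 - (q + δ) ∈ Set.Icc (0 : ℝ) 1)
        (⟨by nlinarith, h2⟩ : q + δ * z ∈ Set.Icc (q + δ) (1 - (q + δ)))
      rw [Real.binEntropy_one_sub, min_self] at this
      nlinarith
    · set z' := (1 - 2 * q) / δ - z with hz'
      have e1 : δ * z' = 1 - 2 * q - δ * z := by
        rw [hz']; field_simp
      have e2 : q + δ * z' = 1 - (q + δ * z) := by linarith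
      have hz'3 : 3 - z ≤ z' := by
        have : δ * (3 - z) ≤ δ * z' := by rw [e1]; nlinarith
        exact le_of_mul_le_mul_left this hδ
      have hz'1 : z' ≤ 1 := by
        have : δ * z' ≤ δ * 1 := by rw [e1]; nlinarith
        exact le_of_mul_le_mul_left this hδ
      have := aux_concave_small q δ L z' hq hδ.le hqd hL (by linarith) hz'1
      rw [e2, Real.binEntropy_one_sub] at this
      exact le_trans (mul_le_mul_of_nonneg_left (hm3.trans hz'3) hL0) this

/-- The quartic minorant of the trapezoid. -/
def auxP (z : ℝ) : ℝ := z * (z + 7 / 4) ^ 2 * (21 / 8 - z) / 20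

lemma auxP_nonpos (z : ℝ) (h : z ≤ 0 ∨ 21 / 8 ≤ z) : auxP z ≤ 0 := by
  unfold auxP
  have h1 : z * (21 / 8 - z) ≤ 0 := by
    rcases h with h | h <;> nlinarith
  nlinarith [mul_nonneg (neg_nonneg.2 h1) (sq_nonneg (z + 7 / 4))]

lemma auxP_le (z : ℝ) (h0 : 0 ≤ z) (h1 : z ≤ 21 / 8) : auxP z ≤ min (min z 1) (3 - z) := by
  unfold auxP
  have hA : (z + 7 / 4) ^ 2 * (21 / 8 - z) ≤ 20 := by
    nlinarith [mul_nonneg h0 (sub_nonneg.2 h1), sq_nonneg (z - 7 / 6), mul_nonneg h0 (sq_nonneg (z - 7 / 6))]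
  refine le_min (le_min ?_ ?_) ?_
  · nlinarith
  · have e : 2 * (7 / 4 : ℝ) ^ 4 - z * (z + 7 / 4) ^ 2 * (21 / 8 - z) =
      (z - 7 / 4) ^ 2 * (z ^ 2 + 5 / 2 * (7 / 4) * z + 2 * (7 / 4) ^ 2) := by ring
    have : 0 ≤ (z - 7 / 4) ^ 2 * (z ^ 2 + 5 / 2 * (7 / 4) * z + 2 * (7 / 4) ^ 2) := by positivity
    linarith
  · have e : 20 * (3 - z) - z * (z + 7 / 4) ^ 2 * (21 / 8 - z) =
      z ^ 4 + 7 / 8 * z ^ 3 - 49 / 8 * z ^ 2 - (1029 / 128 + 20) * z + 60 := by ring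
    nlinarith [sq_nonneg (z ^ 2 + 7 / 16 * z - 11 / 2), sq_nonneg (z - 9 / 4), sq_nonneg (z ^ 2 - 21 / 4)]

/-- Centered letter. -/
def auxY (q : ℝ) (j : Fin 2) : ℝ := if j = 1 then 1 - q else -q

def auxS (q : ℝ) {n : ℕ} (x : Fin n → Fin 2) : ℝ := ∑ i, auxY q (x i)

def auxE (q : ℝ) (n : ℕ) (h : ℝ → ℝ) : ℝ := ∑ x : Fin n → Fin 2, prodProb (bern q) x * h (auxS q x)

lemma auxE_succ (q : ℝ) (n : ℕ) (h : ℝ → ℝ) :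
    auxE q (n + 1) h = (1 - q) * auxE q n (fun s => h (-q + s)) +
      q * auxE q n (fun s => h (1 - q + s)) := by
  unfold auxE
  rw [← (Fin.consEquiv (fun _ => Fin 2)).sum_comp, Fintype.sum_prod_type, Fin.sum_univ_two,
    Finset.mul_sum, Finset.mul_sum]
  congr 1 <;> refine Finset.sum_congr rfl fun x _ => ?_ <;>
    simp [Fin.consEquiv, prodProb, auxS, Fin.prod_univ_succ, Fin.sum_univ_succ, bern, auxY] <;> ring

lemma auxE_add (q : ℝ) (n : ℕ) (f g : ℝ → ℝ) :
    auxE q n (fun s => f s + g s) = auxE q n f + auxE q n g := by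
  simp [auxE, mul_add, Finset.sum_add_distrib]

lemma auxE_smul (q : ℝ) (n : ℕ) (c : ℝ) (f : ℝ → ℝ) :
    auxE q n (fun s => c * f s) = c * auxE q n f := by
  simp only [auxE, Finset.mul_sum]
  exact Finset.sum_congr rfl fun x _ => by ring

/-- Expectation of a quartic. -/
lemma auxE_quartic (q : ℝ) (n : ℕ) : ∀ a b c d e : ℝ,
    auxE q n (fun s => a + b * s + c * s ^ 2 + d * s ^ 3 + e * s ^ 4) =
      a + c * (n * (q * (1 - q))) + d * (n * (q * (1 - q) * (1 - 2 * q))) +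
      e * (3 * n ^ 2 * (q * (1 - q)) ^ 2 + n * (q * (1 - q)) * (1 - 6 * (q * (1 - q)))) := by
  induction n with
  | zero => intro a b c d e; simp [auxE, prodProb, auxS]
  | succ n ih =>
    intro a b c d e
    rw [auxE_succ]
    have e1 : ∀ v : ℝ, (fun s : ℝ => a + b * (v + s) + c * (v + s) ^ 2 + d * (v + s) ^ 3
        + e * (v + s) ^ 4) = fun s => (a + b * v + c * v ^ 2 + d * v ^ 3 + e * v ^ 4) +
        (b + 2 * c * v + 3 * d * v ^ 2 + 4 * e * v ^ 3) * s +
        (c + 3 * d * v + 6 * e * v ^ 2) * s ^ 2 + (d + 4 * e * v) * s ^ 3 + e * s ^ 4 := by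
      intro v; funext s; ring
    rw [e1, e1, ih, ih]
    push_cast
    ring

lemma aux_Phi : stdNormalCDF 2 - stdNormalCDF 1 ≤ 5 / 32 := by
  unfold stdNormalCDF
  have hint : Integrable (fun t : ℝ => Real.exp (-(t ^ 2) / 2) / Real.sqrt (2 * Real.pi)) := by
    apply Integrable.div_const
    have := integrable_exp_neg_mul_sq (b := 1 / 2) (by norm_num)
    convert this using 3
    ring
  rw [intervalIntegral.integral_Iic_sub_Iic hint.integrableOn hint.integrableOn]
  have hle : ∫ t in (1 : ℝ)..2, Real.exp (-(t ^ 2) / 2) / Real.sqrt (2 * Real.pi) ≤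
      ∫ t in (1 : ℝ)..2, Real.exp (1 / 2 - t) / Real.sqrt (2 * Real.pi) := by
    apply intervalIntegral.integral_mono_on (by norm_num) hint.intervalIntegrable
    · exact (by fun_prop : Continuous fun t : ℝ =>
        Real.exp (1 / 2 - t) / Real.sqrt (2 * Real.pi)).intervalIntegrable _ _
    · intro t _
      gcongr
      nlinarith [sq_nonneg (t - 1)]
  refine hle.trans ?_
  have hval : ∫ t in (1 : ℝ)..2, Real.exp (1 / 2 - t) / Real.sqrt (2 * Real.pi) =
      (Real.exp (-(1 / 2)) - Real.exp (-(1 / 2)) ^ 3) / Real.sqrt (2 * Real.pi) := by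
    rw [intervalIntegral.integral_div, intervalIntegral.integral_comp_sub_left (fun t => Real.exp t),
      integral_exp, ← Real.exp_nat_mul]
    norm_num
  rw [hval]
  set y := Real.exp (-(1 / 2)) with hy
  have hy0 : 0 < y := Real.exp_pos _
  have hy2 : y ^ 2 = Real.exp (-1) := by rw [hy, ← Real.exp_nat_mul]; norm_num
  have hl := Real.exp_neg_one_gt_d9
  have hu := Real.exp_neg_one_lt_d9
  rw [← hy2] at hl hu
  have hs : (5 / 2 : ℝ) ≤ Real.sqrt (2 * Real.pi) := by
    apply Real.le_sqrt_of_sq_le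
    have := Real.pi_gt_d2
    linarith
  have hy1 : y ≤ 0.607 := by nlinarith
  rw [div_le_iff₀ (by linarith)]
  have : y - y ^ 3 = y * (1 - y ^ 2) := by ring
  rw [this]
  have : y * (1 - y ^ 2) ≤ 0.607 * (1 - 0.3678) := by
    apply mul_le_mul hy1 (by linarith) (by linarith) (by norm_num)
  linarith

lemma aux_type {n : ℕ} (hn : 0 < n) (x : Fin n → Fin 2) : IsProb (typeOf x) := by
  refine ⟨fun a => by unfold typeOf; positivity, ?_⟩
  unfold typeOf
  rw [← Finset.sum_div, div_eq_one_iff_eq (by positivity)]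
  have := Finset.card_eq_sum_card_fiberwise (f := x) (s := Finset.univ) (t := Finset.univ)
    (fun _ _ => Finset.mem_coe.2 (Finset.mem_univ _))
  rw [Finset.card_univ, Fintype.card_fin] at this
  exact_mod_cast this.symm

lemma aux_type_one {n : ℕ} (hn : 0 < n) (q : ℝ) (x : Fin n → Fin 2) :
    typeOf x 1 = q + auxS q x / n := by
  have hn' : (n : ℝ) ≠ 0 := by positivity
  have : auxS q x = ((Finset.univ.filter fun i => x i = 1).card : ℝ) - n * q := by
    unfold auxS
    have e : ∀ i, auxY q (x i) = (if x i = 1 then 1 else 0) - q := by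
      intro i; unfold auxY; split_ifs <;> ring
    simp only [e, Finset.sum_sub_distrib]
    simp
  rw [this]
  unfold typeOf
  field_simp
  ring

lemma aux_prod_nonneg {n : ℕ} (q : ℝ) (hq : 0 < q) (hq2 : q < 1 / 2) (x : Fin n → Fin 2) :
    0 ≤ prodProb (bern q) x := by
  refine Finset.prod_nonneg fun i _ => ?_
  unfold bern
  split_ifs <;> linarith

lemma aux_main (m q : ℝ) (hm : 0 < m) (hq : 0 < q) (hq2 : q < 1 / 2) (n : ℕ)
    (hn : 2 * q + 3 * Real.sqrt (q * (1 - q) / n) < 1) :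
    max (Real.sqrt (q * (1 - q) / n) * Real.log ((1 - q) / q) - 1 / (2 * n)) 0
        * max (stdNormalCDF 2 - stdNormalCDF 1
              - ((1 - q) ^ 2 + q ^ 2) / Real.sqrt (n * (q * (1 - q)))) 0
      ≤ expTypeRD n (bern q) (q * m) (binDist m) := by
  rcases Nat.eq_zero_or_pos n with rfl | hn0
  · simp [expTypeRD, prodProb, typeOf, RD, mutualInfo, avgDist]
    apply Real.sInf_nonneg
    rintro r ⟨Q, _, _, rfl⟩
    exact le_rfl
  have hnR : (0 : ℝ) < n := by exact_mod_cast hn0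
  have hE0 : 0 ≤ expTypeRD n (bern q) (q * m) (binDist m) :=
    Finset.sum_nonneg fun x _ => mul_nonneg (aux_prod_nonneg q hq hq2 x)
      (aux_RD_nonneg _ (aux_type hn0 x) _ _)
  set δ := Real.sqrt (q * (1 - q) / n) with hδ
  set s := Real.sqrt (n * (q * (1 - q))) with hs
  set L := δ * Real.log ((1 - q) / q) - 1 / (2 * n) with hL
  set C := stdNormalCDF 2 - stdNormalCDF 1 - ((1 - q) ^ 2 + q ^ 2) / s with hC
  rcases le_total L 0 with hL0 | hL0
  · rw [max_eq_right hL0, zero_mul]; exact hE0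
  rcases le_total C 0 with hC0 | hC0
  · rw [max_eq_right hC0, mul_zero]; exact hE0
  rw [max_eq_left hL0, max_eq_left hC0]
  have hpq : 0 < q * (1 - q) := mul_pos hq (by linarith)
  have hs0 : 0 < s := Real.sqrt_pos.2 (by positivity)
  have hδ0 : 0 < δ := Real.sqrt_pos.2 (by positivity)
  have hs2 : s ^ 2 = n * (q * (1 - q)) := Real.sq_sqrt (by positivity)
  have hδ2 : δ ^ 2 = q * (1 - q) / n := Real.sq_sqrt (by positivity)
  have hδs : δ = s / n := by
    rw [hδ, Real.sqrt_eq_iff_mul_self_eq (by positivity) (by positivity)]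
    field_simp
    linarith
  have hLH : L ≤ Real.binEntropy (q + δ) - Real.binEntropy q := by
    have := aux_taylor q δ hq hδ0.le (by linarith)
    rw [hδ2] at this
    have e : q * (1 - q) / n / (2 * (q * (1 - q))) = 1 / (2 * n) := by
      have : 1 - q ≠ 0 := by linarith
      field_simp
    rw [e] at this
    exact this
  -- pointwise bound
  have hpt : ∀ x : Fin n → Fin 2, L * auxP (auxS q x / s) ≤
      RD (typeOf x) (q * m) (binDist m) := by
    intro x
    have hT := aux_type hn0 x
    set z := auxS q x / s with hz
    by_cases hzz : z ≤ 0 ∨ 21 / 8 ≤ z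
    · exact le_trans (mul_nonpos_of_nonneg_of_nonpos hL0 (auxP_nonpos z hzz))
        (aux_RD_nonneg _ hT _ _)
    · push Not at hzz
      refine le_trans ?_ (aux_RD_lower _ hT m q hm hq hq2)
      have e : typeOf x 1 = q + δ * z := by
        rw [aux_type_one hn0 q x, hδs, hz]
        field_simp
      rw [e]
      exact le_trans (mul_le_mul_of_nonneg_left (auxP_le z hzz.1.le hzz.2.le) hL0)
        (aux_trap q δ L z hq hδ0 hn hL0 hLH hzz.1.le (by linarith))
  have hE : L * auxE q n (fun t => auxP (t / s)) ≤ expTypeRD n (bern q) (q * m) (binDist m) := by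
    unfold auxE expTypeRD
    rw [Finset.mul_sum]
    refine Finset.sum_le_sum fun x _ => ?_
    have := mul_le_mul_of_nonneg_left (hpt x) (aux_prod_nonneg q hq hq2 x)
    linarith
  refine le_trans (mul_le_mul_of_nonneg_left ?_ hL0) hE
  have hfun : (fun t => auxP (t / s)) = fun t => 0 + (1029 / 128 / 20 / s) * t +
      (49 / 8 / 20 / s ^ 2) * t ^ 2 + (-(7 / 8) / 20 / s ^ 3) * t ^ 3 +
      (-1 / 20 / s ^ 4) * t ^ 4 := by
    funext t; unfold auxP; field_simp; ring
  rw [hfun, auxE_quartic]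
  have hval : 0 + 49 / 8 / 20 / s ^ 2 * (n * (q * (1 - q))) +
      -(7 / 8) / 20 / s ^ 3 * (n * (q * (1 - q) * (1 - 2 * q))) +
      -1 / 20 / s ^ 4 * (3 * n ^ 2 * (q * (1 - q)) ^ 2 +
        n * (q * (1 - q)) * (1 - 6 * (q * (1 - q)))) =
      5 / 32 - (7 / 160 * (1 - 2 * q) + (1 - 6 * (q * (1 - q))) / 20 / s) / s := by
    have e1 : n * (q * (1 - q) * (1 - 2 * q)) = s ^ 2 * (1 - 2 * q) := by rw [hs2]; ring
    have e2 : 3 * n ^ 2 * (q * (1 - q)) ^ 2 = 3 * (s ^ 2) ^ 2 := by rw [hs2]; ring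
    rw [e1, e2, ← hs2]
    field_simp
    ring
  rw [hval]
  have hPhi := aux_Phi
  have hs1 : 1 ≤ s := by
    have h1 : ((1 - q) ^ 2 + q ^ 2) / s ≤ 5 / 32 := by linarith
    rw [div_le_iff₀ hs0] at h1
    nlinarith [sq_nonneg (1 - 2 * q)]
  have hfin : (7 / 160 * (1 - 2 * q) + (1 - 6 * (q * (1 - q))) / 20 / s) / s ≤
      ((1 - q) ^ 2 + q ^ 2) / s := by
    apply div_le_div_of_nonneg_right _ hs0.le
    have : (1 - 6 * (q * (1 - q))) / 20 / s ≤ 1 / 20 := by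
      rw [div_le_iff₀ hs0]
      nlinarith
    nlinarith [sq_nonneg (1 - 2 * q)]
  linarith

/-- Lemma 9: for the binary Hamming case with `d ∈ (0, ρmax/2)` and
source Bernoulli(`d̄`), `d̄ = d/ρmax`, for every `n` with `2d̄ + 3√(d̄(1−d̄)/n) < 1`,
`E_p[R(T,d,ρ)] − R(p,d,ρ) ≥ [√(d̄(1−d̄)/n) ln((1−d̄)/d̄) − 1/(2n)]⁺ ·
  [Φ(2) − Φ(1) − ((1−d̄)² + d̄²)/√(n d̄(1−d̄))]⁺`. -/
theorem expTypeRD_lower_bound_binary (ρmax : ℝ) (hρmax : 0 < ρmax)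
    (d : ℝ) (hd : 0 < d) (hd2 : d < ρmax / 2) (n : ℕ)
    (hn : 2 * (d / ρmax) + 3 * Real.sqrt ((d / ρmax) * (1 - d / ρmax) / n) < 1) :
    expTypeRD n (bern (d / ρmax)) d (binDist ρmax)
        - RD (bern (d / ρmax)) d (binDist ρmax)
      ≥ max (Real.sqrt ((d / ρmax) * (1 - d / ρmax) / n) *
              Real.log ((1 - d / ρmax) / (d / ρmax)) - 1 / (2 * n)) 0
        * max (stdNormalCDF 2 - stdNormalCDF 1
              - ((1 - d / ρmax) ^ 2 + (d / ρmax) ^ 2) /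
                  Real.sqrt (n * ((d / ρmax) * (1 - d / ρmax)))) 0 := by
  have hq : 0 < d / ρmax := div_pos hd hρmax
  have hq2 : d / ρmax < 1 / 2 := by rw [div_lt_iff₀ hρmax]; linarith
  have e : d / ρmax * ρmax = d := div_mul_cancel₀ d hρmax.ne'
  have h1 := aux_main ρmax (d / ρmax) hρmax hq hq2 n hn
  have h2 := aux_RD_bern ρmax (d / ρmax) hρmax hq hq2
  rw [e] at h1 h2
  linarith
end
end
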